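/- Let 0 < ε < 1 and C > 0 be constants. There exist constants r₀ and c (depending only on C and ε) such that the following holds for all sufficiently large n. Let A = (a_{ij}) be an n×n real matrix with ρ_b(A) ≥ n^{−C}. Then there exist index sets I₀, J₀ ⊆ {1,…,n} with |I₀|, |J₀| ≤ r₀, index sets I, J ⊆ {1,…,n} with |I|, |J| ≥ n − c·n^ε, I ∩ I₀ = ∅ and J ∩ J₀ = ∅, nonzero integers k, l with |k|, |l| ≤ n^c, integers k_{i i₀} (i ∈ I, i₀ ∈ I₀) and l_{j₀ j} (j ∈ J, j₀ ∈ J₀) all of absolute value at most n^c, and real numbers a'_{ij} (i ∈ I, j ∈ J), such that for every i ∈ I: (i) a_{ij} = a'_{ij}/(kl) − Σ_{i₀∈I₀} k_{i i₀} a_{i₀ j}/k − Σ_{j₀∈J₀} l_{j₀ j} a_{i j₀}/l for all j ∈ J; and (ii) all but at most c·n^ε of the numbers a'_{ij}, j ∈ J, belong to a proper symmetric GAP Q_i (which may depend on i) of rank at most r₀ and size at most n^c. -/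

import Mathlib

open scoped Classical BigOperators

noncomputable section

/-- `Q` is a proper symmetric generalized arithmetic progression (GAP) of rank at most `r`
and size at most `s`. -/
def IsProperSymGAPSet (Q : Set ℝ) (r : ℕ) (s : ℝ) : Prop :=
  ∃ (r' : ℕ) (g : Fin r' → ℝ) (N : Fin r' → ℕ),
    r' ≤ r ∧
    Q = {x : ℝ | ∃ m : Fin r' → ℤ, (∀ i, |m i| ≤ (N i : ℤ)) ∧ x = ∑ i, (m i : ℝ) * g i} ∧
    (∀ m m' : Fin r' → ℤ, (∀ i, |m i| ≤ (N i : ℤ)) → (∀ i, |m' i| ≤ (N i : ℤ)) →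
      (∑ i, (m i : ℝ) * g i) = (∑ i, (m' i : ℝ) * g i) → m = m') ∧
    (∏ i, (2 * (N i : ℝ) + 1)) ≤ s

/-- The real number (±1) corresponding to a Boolean sign bit. -/
def signv (b : Bool) : ℝ := if b then 1 else -1

/-- The bilinear concentration probability `ρ_b(A) = sup_a P(Σ a_{ij} x_i y_j = a)`, where
`x` and `y` are vectors of iid Rademacher random variables. -/
def rhoB (n : ℕ) (A : Matrix (Fin n) (Fin n) ℝ) : ℝ :=
  ⨆ a : ℝ, ((Finset.univ.filter fun xy : (Fin n → Bool) × (Fin n → Bool) =>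
      ∑ i, ∑ j, A i j * signv (xy.1 i) * signv (xy.2 j) = a).card : ℝ) / 2 ^ (2 * n)

open AddMonoidAlgebra in
/-- The law of `v` times a Rademacher variable, as an element of the group algebra of `ℝ`. -/
def bern (v : ℝ) : AddMonoidAlgebra ℝ ℝ := single v (1 / 2) + single (-v) (1 / 2)

/-- The involution of the group algebra induced by `x ↦ -x`. -/
def reflect : AddMonoidAlgebra ℝ ℝ →+* AddMonoidAlgebra ℝ ℝ :=
  AddMonoidAlgebra.mapDomainRingHom ℝ (-AddMonoidHom.id ℝ)

lemma reflect_bern (v : ℝ) : reflect (bern v) = bern v := by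
  rw [reflect, bern, map_add]
  simp [add_comm]

lemma coeff_reflect (f : AddMonoidAlgebra ℝ ℝ) (x : ℝ) : (reflect f).coeff x = f.coeff (-x) := by
  have h := Finsupp.mapDomain_apply (f := ⇑(-AddMonoidHom.id ℝ)) neg_injective f.coeff (-x)
  simpa [reflect] using h

lemma coeff_zero_mul_self (f : AddMonoidAlgebra ℝ ℝ) (hf : reflect f = f) :
    (f * f).coeff 0 = ∑ x ∈ f.coeff.support, f.coeff x ^ 2 := by
  classical
  have key : ∀ g h : AddMonoidAlgebra ℝ ℝ,
      (g * h).coeff 0 = ∑ x ∈ g.coeff.support, g.coeff x * h.coeff (-x) := by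
    intro g h
    have h1 : g = ∑ x ∈ g.coeff.support, AddMonoidAlgebra.single x (g.coeff x) :=
      (AddMonoidAlgebra.sum_coeff_single g).symm
    conv_lhs => rw [h1, Finset.sum_mul]
    rw [AddMonoidAlgebra.coeff_sum]
    simp
  rw [key]
  refine Finset.sum_congr rfl fun x _ => ?_
  rw [← coeff_reflect, hf, sq]

lemma bern_mul_coeff (v : ℝ) (f : AddMonoidAlgebra ℝ ℝ) (x : ℝ) :
    (bern v * f).coeff x = (f.coeff (x - v) + f.coeff (x + v)) / 2 := by
  simp [bern, add_mul]
  ring_nf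

lemma coeff_zero_mul_le (f g : AddMonoidAlgebra ℝ ℝ) (hf : reflect f = f) (hg : reflect g = g) :
    (f * g).coeff 0 ≤ ((f * f).coeff 0 + (g * g).coeff 0) / 2 := by
  have h : 0 ≤ ((f - g) * (f - g)).coeff 0 := by
    rw [coeff_zero_mul_self _ (by rw [map_sub, hf, hg])]
    positivity
  have e : (f - g) * (f - g) = f * f + g * g - (f * g + f * g) := by ring
  rw [e] at h
  simp at h
  linarith

/-- Iterated arithmetic–geometric mean inequality for the trace of a product. -/
lemma coeff_zero_prod_le {ι : Type*} (t : ℕ) : ∀ (X : ι → AddMonoidAlgebra ℝ ℝ)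
    (_ : ∀ h, reflect (X h) = X h) (g : AddMonoidAlgebra ℝ ℝ) (_ : reflect g = g)
    (B : Finset ι) (_ : B.card = 2 ^ t),
    2 ^ t * ((∏ h ∈ B, X h) * g ^ 2).coeff 0 ≤ ∑ h ∈ B, (X h ^ 2 ^ t * g ^ 2).coeff 0 := by
  classical
  induction t with
  | zero =>
    intro X hX g hg B hB
    obtain ⟨b, rfl⟩ := Finset.card_eq_one.1 (by simpa using hB)
    simp
  | succ t ih =>
    intro X hX g hg B hB
    obtain ⟨S, hS, hSc⟩ := Finset.exists_subset_card_eq (s := B) (n := 2 ^ t)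
      (by rw [hB, pow_succ]; omega)
    have hTc : (B \ S).card = 2 ^ t := by
      rw [Finset.card_sdiff_of_subset hS, hB, hSc, pow_succ]; omega
    have h1 := ih (fun h => X h ^ 2) (fun h => by simp [hX]) g hg S hSc
    have h2 := ih (fun h => X h ^ 2) (fun h => by simp [hX]) g hg (B \ S) hTc
    have hr : ∀ U : Finset ι, reflect ((∏ h ∈ U, X h) * g) = (∏ h ∈ U, X h) * g := by
      intro U; simp [map_prod, hX, hg]
    have h3 := coeff_zero_mul_le _ _ (hr S) (hr (B \ S))
    have e1 : (∏ h ∈ S, X h) * g * ((∏ h ∈ B \ S, X h) * g) = (∏ h ∈ B, X h) * g ^ 2 := by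
      rw [← Finset.prod_sdiff hS]; ring
    have e2 : ∀ U : Finset ι, (∏ h ∈ U, X h) * g * ((∏ h ∈ U, X h) * g)
        = (∏ h ∈ U, X h ^ 2) * g ^ 2 := by
      intro U; rw [Finset.prod_pow]; ring
    rw [e1, e2, e2] at h3
    rw [← Finset.sum_sdiff hS]
    have e3 : ∀ h, (X h ^ 2) ^ 2 ^ t = X h ^ 2 ^ (t + 1) := by
      intro h; rw [← pow_mul]; congr 1; ring
    simp only [e3] at h1 h2
    have : (0 : ℝ) < 2 ^ t := by positivity
    rw [pow_succ]
    nlinarith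

lemma bern_pow_mul_coeff (v : ℝ) (t : ℕ) (f : AddMonoidAlgebra ℝ ℝ) (x : ℝ) :
    (bern v ^ t * f).coeff x = ∑ i ∈ Finset.range (t + 1),
      (t.choose i : ℝ) / 2 ^ t * f.coeff (x - (2 * i - t) * v) := by
  rw [bern, add_pow, Finset.sum_mul, AddMonoidAlgebra.coeff_sum, Finsupp.finsetSum_apply]
  refine Finset.sum_congr rfl fun i hi => ?_
  have hi' : i ≤ t := by simpa [Nat.lt_succ_iff] using hi
  have e : AddMonoidAlgebra.single v (1 / 2 : ℝ) ^ i * AddMonoidAlgebra.single (-v) (1 / 2 : ℝ) ^ (t - i)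
      * (t.choose i : AddMonoidAlgebra ℝ ℝ)
      = AddMonoidAlgebra.single ((2 * i - t) * v) ((t.choose i : ℝ) / 2 ^ t) := by
    rw [AddMonoidAlgebra.single_pow, AddMonoidAlgebra.single_pow,
      AddMonoidAlgebra.single_mul_single, ← pow_add, Nat.add_sub_cancel' hi',
      AddMonoidAlgebra.natCast_def, AddMonoidAlgebra.single_mul_single]
    congr 1
    · simp only [nsmul_eq_mul]; push_cast [hi']; ring
    · rw [div_pow, one_pow]; ring
  rw [e, AddMonoidAlgebra.coeff_single_mul_apply]
  congr 2
  ring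

lemma bern_pow_mul_nonneg (v : ℝ) (t : ℕ) (f : AddMonoidAlgebra ℝ ℝ) (hf : ∀ x, 0 ≤ f.coeff x)
    (x : ℝ) : 0 ≤ (bern v ^ t * f).coeff x := by
  rw [bern_pow_mul_coeff]
  exact Finset.sum_nonneg fun i _ => mul_nonneg (by positivity) (hf _)

lemma bern_pow_mul_le (v : ℝ) (t : ℕ) (f : AddMonoidAlgebra ℝ ℝ) (B : ℝ)
    (hf : ∀ x, f.coeff x ≤ B) (x : ℝ) : (bern v ^ t * f).coeff x ≤ B := by
  induction t generalizing x with
  | zero => simpa using hf x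
  | succ t ih =>
    rw [pow_succ', mul_assoc, bern_mul_coeff]
    linarith [ih (x - v), ih (x + v)]

lemma centralBinom_sq_mul_le (m : ℕ) :
    (m.centralBinom : ℝ) ^ 2 * (2 * m + 1) ≤ (4 ^ m) ^ 2 := by
  induction m with
  | zero => simp
  | succ m ih =>
    have h : ((m : ℝ) + 1) * (m + 1).centralBinom = 2 * (2 * m + 1) * m.centralBinom := by
      exact_mod_cast Nat.succ_mul_centralBinom_succ m
    have hm : (0 : ℝ) < (m + 1) ^ 2 := by positivity
    refine le_of_mul_le_mul_left ?_ hm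
    push_cast
    have e : ((m : ℝ) + 1) ^ 2 * (((m + 1).centralBinom : ℝ) ^ 2 * (2 * (m + 1) + 1))
      = (2 * (2 * m + 1) * m.centralBinom) ^ 2 * (2 * m + 3) := by
      rw [← h]; ring
    rw [e]
    have h5 : (2 * (2 * (m : ℝ) + 1) * m.centralBinom) ^ 2 * (2 * m + 3)
       = 4 * ((2 * m + 1) * (2 * m + 3)) * ((m.centralBinom : ℝ) ^ 2 * (2 * m + 1)) := by ring
    rw [h5]
    calc _ ≤ 4 * ((2 * (m : ℝ) + 1) * (2 * m + 3)) * (4 ^ m) ^ 2 := by gcongr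
      _ ≤ (4 * (4 * (m + 1) ^ 2)) * (4 ^ m) ^ 2 := by
        gcongr 4 * ?_ * _; nlinarith
      _ = _ := by rw [pow_succ]; ring

lemma choose_div_le (t i : ℕ) : (t.choose i : ℝ) / 2 ^ t ≤ 1 / √(t + 1) := by
  have key : (t.choose i : ℝ) ^ 2 * (t + 1) ≤ (2 ^ t) ^ 2 := by
    rcases Nat.even_or_odd' t with ⟨m, rfl | rfl⟩
    · have h1 : ((2 * m).choose i : ℝ) ≤ m.centralBinom := by
        exact_mod_cast Nat.choose_le_centralBinom i m
      have h2 := centralBinom_sq_mul_le m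
      calc _ ≤ (m.centralBinom : ℝ) ^ 2 * ((2 * m : ℕ) + 1) := by gcongr
        _ ≤ _ := by push_cast; rw [pow_mul]; norm_num; exact h2
    · have h1 : 2 * ((2 * m + 1).choose i) ≤ (m + 1).centralBinom := by
        have h := Nat.choose_le_middle i (2 * m + 1)
        rw [show (2 * m + 1) / 2 = m by omega] at h
        rw [Nat.centralBinom, show 2 * (m + 1) = 2 * m + 1 + 1 by ring, Nat.choose_succ_succ,
          Nat.choose_symm_half]
        omega
      have h1' : 2 * ((2 * m + 1).choose i : ℝ) ≤ (m + 1).centralBinom := by exact_mod_cast h1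
      have h2 := centralBinom_sq_mul_le (m + 1)
      have h3 : (2 * ((2 * m + 1).choose i : ℝ)) ^ 2 * (2 * (m + 1) + 1) ≤ (4 ^ (m + 1)) ^ 2 := by
        push_cast at h2
        refine le_trans ?_ h2
        gcongr
      have e : ((4 : ℝ) ^ (m + 1)) ^ 2 = 4 * (2 ^ (2 * m + 1)) ^ 2 := by
        rw [show (4 : ℝ) = 2 ^ 2 by norm_num, ← pow_mul, ← pow_mul, ← pow_mul, ← pow_add]
        congr 1; ring
      rw [e] at h3
      push_cast
      nlinarith [sq_nonneg ((2 * m + 1).choose i : ℝ)]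
  rw [div_le_div_iff₀ (by positivity) (by positivity), one_mul]
  refine le_of_sq_le_sq ?_ (by positivity)
  rw [mul_pow, Real.sq_sqrt (by positivity)]
  exact key

lemma bern_pow_mul_le_of_unique (v : ℝ) (t M : ℕ) (htM : t ≤ M) (f : AddMonoidAlgebra ℝ ℝ) (B : ℝ)
    (hf0 : ∀ x, 0 ≤ f.coeff x) (hf : ∀ x, f.coeff x ≤ B)
    (hu : ∀ x, ∀ b : ℕ, 1 ≤ b → b ≤ t → f.coeff x ≠ 0 → f.coeff (x + 2 * b * v) = 0) (x : ℝ) :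
    (bern v ^ M * f).coeff x ≤ B / √(t + 1) := by
  have hB : 0 ≤ B := (hf0 0).trans (hf 0)
  obtain ⟨s, rfl⟩ := Nat.exists_eq_add_of_le htM
  rw [add_comm, pow_add, mul_assoc]
  refine bern_pow_mul_le _ _ _ _ (fun y => ?_) x
  rw [bern_pow_mul_coeff]
  by_cases h : ∃ i ∈ Finset.range (t + 1), f.coeff (y - (2 * i - t) * v) ≠ 0
  · obtain ⟨i, hi, hne⟩ := h
    rw [Finset.sum_eq_single_of_mem i hi]
    · calc _ ≤ 1 / √(t + 1) * B := mul_le_mul (choose_div_le t i) (hf _) (hf0 _) (by positivity)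
        _ = _ := by ring
    · intro j hj hji
      rw [Finset.mem_range] at hi hj
      suffices f.coeff (y - (2 * j - t) * v) = 0 by rw [this, mul_zero]
      by_contra hne2
      rcases lt_or_gt_of_ne hji with hlt | hlt
      · refine hne2 ?_
        have := hu _ (i - j) (by omega) (by omega) hne
        rw [← this]; congr 1; push_cast [hlt.le]; ring
      · refine hne ?_
        have := hu _ (j - i) (by omega) (by omega) hne2
        rw [← this]; congr 1; push_cast [hlt.le]; ring
  · push Not at h
    rw [Finset.sum_eq_zero fun i hi => by rw [h i hi, mul_zero]]
    positivity

lemma prod_bern_pow_nonneg {ι : Type*} (v : ι → ℝ) (M : ℕ) (W : Finset ι) (x : ℝ) :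
    0 ≤ (∏ i ∈ W, bern (v i) ^ M).coeff x := by
  induction W using Finset.induction_on generalizing x with
  | empty =>
    rw [Finset.prod_empty, AddMonoidAlgebra.one_def, AddMonoidAlgebra.coeff_single,
      Finsupp.single_apply]
    split_ifs <;> norm_num
  | insert a W ha ih =>
    rw [Finset.prod_insert ha]
    exact bern_pow_mul_nonneg _ _ _ ih _

lemma exists_eq_sum_of_coeff_prod_ne_zero {ι : Type*} (v : ι → ℝ) (M : ℕ) (W : Finset ι) (x : ℝ)
    (hx : (∏ i ∈ W, bern (v i) ^ M).coeff x ≠ 0) :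
    ∃ k : ι → ℤ, (∀ i, 0 ≤ k i ∧ k i ≤ M) ∧ x = ∑ i ∈ W, (2 * (k i : ℝ) - M) * v i := by
  induction W using Finset.induction_on generalizing x with
  | empty =>
    refine ⟨0, by simp, ?_⟩
    rw [Finset.prod_empty, AddMonoidAlgebra.one_def, AddMonoidAlgebra.coeff_single,
      Finsupp.single_apply] at hx
    by_contra hne
    exact hx (if_neg fun h => hne (by simp [← h]))
  | insert a W ha ih =>
    rw [Finset.prod_insert ha, bern_pow_mul_coeff] at hx
    obtain ⟨j, hj, hne⟩ := Finset.exists_ne_zero_of_sum_ne_zero hx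
    obtain ⟨k, hk, hs⟩ := ih _ (right_ne_zero_of_mul hne)
    rw [Finset.mem_range] at hj
    refine ⟨Function.update k a j, fun i => ?_, ?_⟩
    · by_cases hi : i = a
      · subst hi
        rw [Function.update_self]
        constructor <;> omega
      · rw [Function.update_of_ne hi]
        exact hk i
    · rw [Finset.sum_insert ha, Function.update_self]
      have : ∑ i ∈ W, (2 * ((Function.update k a (j : ℤ) i : ℤ) : ℝ) - M) * v i
          = ∑ i ∈ W, (2 * (k i : ℝ) - M) * v i := by
        refine Finset.sum_congr rfl fun i hi => ?_
        rw [Function.update_of_ne (ne_of_mem_of_not_mem hi ha)]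
      rw [this, ← hs]
      push_cast
      ring

lemma coeff_prod_insert_le {ι : Type*} (v : ι → ℝ) (M t : ℕ) (htM : t ≤ M) (W : Finset ι) (h : ι)
    (hh : h ∉ W) (B : ℝ) (hB : ∀ x, (∏ i ∈ W, bern (v i) ^ M).coeff x ≤ B)
    (hrel : ∀ (b : ℕ) (k : ι → ℤ), 1 ≤ b → b ≤ t → (∀ i, |k i| ≤ M) →
      (b : ℝ) * v h ≠ ∑ i ∈ W, (k i : ℝ) * v i) (x : ℝ) :
    (∏ i ∈ insert h W, bern (v i) ^ M).coeff x ≤ B / √(t + 1) := by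
  rw [Finset.prod_insert hh]
  refine bern_pow_mul_le_of_unique _ _ _ htM _ _ (prod_bern_pow_nonneg v M W) hB ?_ x
  intro x b hb1 hbt hx
  by_contra hx2
  obtain ⟨k, hk, hs⟩ := exists_eq_sum_of_coeff_prod_ne_zero _ _ _ _ hx
  obtain ⟨k', hk', hs'⟩ := exists_eq_sum_of_coeff_prod_ne_zero _ _ _ _ hx2
  refine hrel b (k' - k) hb1 hbt (fun i => ?_) ?_
  · rw [Pi.sub_apply, abs_le]
    constructor <;> linarith [(hk i).1, (hk' i).1, (hk i).2, (hk' i).2]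
  · have e : ∑ i ∈ W, (((k' - k) i : ℤ) : ℝ) * v i = ((x + 2 * b * v h) - x) / 2 := by
      rw [hs', hs, ← Finset.sum_sub_distrib, Finset.sum_div]
      refine Finset.sum_congr rfl fun i _ => ?_
      simp only [Pi.sub_apply]
      push_cast
      ring
    rw [e]
    ring

/-- One step of the selection process: a block of `2 ^ t` factors may be replaced by `2 ^ t`
copies of one of them. -/
lemma exists_replace_block {ι : Type*} (v : ι → ℝ) (t : ℕ) (W R B : Finset ι) (hBR : B ⊆ R)
    (hB : B.card = 2 ^ t) (hWR : Disjoint W R) :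
    ∃ h ∈ B, ((∏ i ∈ W, bern (v i) ^ (2 * 2 ^ t)) * ∏ i ∈ R, bern (v i) ^ 2).coeff 0 ≤
      ((∏ i ∈ insert h W, bern (v i) ^ (2 * 2 ^ t)) * ∏ i ∈ R \ B, bern (v i) ^ 2).coeff 0 := by
  have hpos : (0 : ℝ) < 2 ^ t := by positivity
  have key := coeff_zero_prod_le t (fun i => bern (v i) ^ 2) (fun i => by simp [reflect_bern])
    ((∏ i ∈ W, bern (v i) ^ 2 ^ t) * ∏ i ∈ R \ B, bern (v i))
    (by simp [map_prod, reflect_bern]) B hB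
  have e1 : (∏ i ∈ B, bern (v i) ^ 2) *
      ((∏ i ∈ W, bern (v i) ^ 2 ^ t) * ∏ i ∈ R \ B, bern (v i)) ^ 2
      = (∏ i ∈ W, bern (v i) ^ (2 * 2 ^ t)) * ∏ i ∈ R, bern (v i) ^ 2 := by
    rw [← Finset.prod_sdiff hBR, mul_pow, ← Finset.prod_pow, ← Finset.prod_pow]
    simp only [← pow_mul, mul_comm (2 ^ t) 2]
    ring
  rw [e1] at key
  by_contra! hcon
  refine absurd key (not_le.2 ?_)
  have hBne : B.Nonempty := Finset.card_pos.1 (by rw [hB]; positivity)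
  calc _ < ∑ _h ∈ B, ((∏ i ∈ W, bern (v i) ^ (2 * 2 ^ t)) * ∏ i ∈ R, bern (v i) ^ 2).coeff 0 := ?_
    _ = _ := by rw [Finset.sum_const, hB]; simp
  refine Finset.sum_lt_sum_of_nonempty hBne fun h hh => ?_
  have hhW : h ∉ W := Finset.disjoint_right.1 hWR (hBR hh)
  convert hcon h hh using 2
  rw [Finset.prod_insert hhW, mul_pow, ← Finset.prod_pow, ← Finset.prod_pow]
  simp only [← pow_mul, mul_comm (2 ^ t) 2]
  ring_nf

/-- The greedy selection process: starting from the empty set, elements are added one at a time,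
keeping the property `Φ`, until only few elements could be added or `D` of them were found. -/
lemma exists_greedy {ι : Type*} [Fintype ι] (v : ι → ℝ) (t : ℕ) (Φ : Finset ι → Prop)
    (h0 : Φ ∅) (D : ℕ) :
    ∃ W : Finset ι, Φ W ∧ W.card ≤ D ∧
      (∀ B : ℝ, (∀ x, (∏ i ∈ W, bern (v i) ^ (2 * 2 ^ t)).coeff x ≤ B) →
        (∏ i, bern (v i) ^ 2).coeff 0 ≤ B) ∧
      (W.card = D ∨ ∃ E : Finset ι, E.card ≤ 2 ^ t * (D + 1) ∧
        ∀ h, h ∉ W → Φ (insert h W) → h ∈ E) := by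
  have key : ∃ W R : Finset ι, Φ W ∧ W.card ≤ D ∧ Disjoint W R ∧ Rᶜ.card ≤ 2 ^ t * W.card ∧
      (∏ i, bern (v i) ^ 2).coeff 0 ≤
        ((∏ i ∈ W, bern (v i) ^ (2 * 2 ^ t)) * ∏ i ∈ R, bern (v i) ^ 2).coeff 0 ∧
      (W.card = D ∨ (R.filter fun h => Φ (insert h W)).card < 2 ^ t) := by
    induction D with
    | zero => exact ⟨∅, Finset.univ, h0, by simp, by simp, by simp, by simp, by simp⟩
    | succ D ih =>
      obtain ⟨W, R, hΦ, hWD, hWR, hR, hle, hor⟩ := ih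
      by_cases hc : (R.filter fun h => Φ (insert h W)).card < 2 ^ t
      · exact ⟨W, R, hΦ, by omega, hWR, hR, hle, Or.inr hc⟩
      · have hWD' : W.card = D := by tauto
        obtain ⟨B, hB, hBc⟩ := Finset.exists_subset_card_eq (not_lt.1 hc)
        have hBR : B ⊆ R := hB.trans (Finset.filter_subset _ _)
        obtain ⟨h, hh, hle'⟩ := exists_replace_block v t W R B hBR hBc hWR
        have hhW : h ∉ W := Finset.disjoint_right.1 hWR (hBR hh)
        refine ⟨insert h W, R \ B, (Finset.mem_filter.1 (hB hh)).2, ?_, ?_, ?_, hle.trans hle', ?_⟩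
        · rw [Finset.card_insert_of_notMem hhW]; omega
        · rw [Finset.disjoint_insert_left]
          exact ⟨by simp [hh], hWR.mono_right Finset.sdiff_subset⟩
        · have hc' : (R \ B)ᶜ = Rᶜ ∪ B := by ext; simp; tauto
          rw [Finset.card_insert_of_notMem hhW, hc', mul_add, mul_one]
          refine (Finset.card_union_le _ _).trans ?_
          omega
        · left; rw [Finset.card_insert_of_notMem hhW, hWD']
  obtain ⟨W, R, hΦ, hWD, hWR, hR, hle, hor⟩ := key
  refine ⟨W, hΦ, hWD, fun B hB => hle.trans ?_, hor.imp_right fun hc => ?_⟩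
  · have : ∀ U : Finset ι, ∀ x, ((∏ i ∈ W, bern (v i) ^ (2 * 2 ^ t)) *
        ∏ i ∈ U, bern (v i) ^ 2).coeff x ≤ B := by
      intro U
      induction U using Finset.induction_on with
      | empty => simpa using hB
      | insert a U ha ih =>
        intro x
        rw [Finset.prod_insert ha, mul_left_comm]
        exact bern_pow_mul_le _ _ _ _ ih x
    exact this R 0
  · refine ⟨Rᶜ ∪ R.filter fun h => Φ (insert h W),
      (Finset.card_union_le _ _).trans (by nlinarith [Nat.mul_le_mul_left (2 ^ t) hWD]), ?_⟩
    intro h _ hh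
    by_cases hhR : h ∈ R <;> simp [hhR, hh]

lemma coeff_prod_bern {ι : Type*} [Fintype ι] (v : ι → ℝ) (x : ℝ) :
    (∏ i, bern (v i)).coeff x =
      ((Finset.univ.filter fun s : ι → Bool => ∑ i, v i * signv (s i) = x).card : ℝ)
        / 2 ^ Fintype.card ι := by
  have e : ∀ i, bern (v i) = ∑ b : Bool, AddMonoidAlgebra.single (v i * signv b) (1 / 2 : ℝ) := by
    intro i
    simp [bern, signv]
  simp only [e]
  rw [Finset.prod_univ_sum, AddMonoidAlgebra.coeff_sum, Finsupp.finsetSum_apply,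
    Fintype.piFinset_univ]
  have e2 : ∀ s : ι → Bool, ∏ i, AddMonoidAlgebra.single (v i * signv (s i)) (1 / 2 : ℝ)
      = AddMonoidAlgebra.single (∑ i, v i * signv (s i)) ((1 / 2 : ℝ) ^ Fintype.card ι) := by
    intro s
    have : ∀ U : Finset ι, ∏ i ∈ U, AddMonoidAlgebra.single (v i * signv (s i)) (1 / 2 : ℝ)
        = AddMonoidAlgebra.single (∑ i ∈ U, v i * signv (s i)) ((1 / 2 : ℝ) ^ U.card) := by
      intro U
      induction U using Finset.induction_on with
      | empty => simp [AddMonoidAlgebra.one_def]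
      | insert a U ha ih =>
        rw [Finset.prod_insert ha, ih, AddMonoidAlgebra.single_mul_single, Finset.sum_insert ha,
          Finset.card_insert_of_notMem ha, pow_succ']
    exact this Finset.univ
  simp only [e2, AddMonoidAlgebra.coeff_single, Finsupp.single_apply]
  rw [← Finset.sum_filter, Finset.sum_const, nsmul_eq_mul, one_div, inv_pow, div_eq_mul_inv]

/-- Symmetrization: a lower bound for a point probability bounds the trace from below. -/
lemma sq_le_coeff_zero_prod {ι : Type*} [Fintype ι] (v : ι → ℝ) (x : ℝ) :
    ((∏ i, bern (v i)).coeff x) ^ 2 ≤ (∏ i, bern (v i) ^ 2).coeff 0 := by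
  have h : reflect (∏ i, bern (v i)) = ∏ i, bern (v i) := by simp [map_prod, reflect_bern]
  rw [Finset.prod_pow, sq (∏ i, bern (v i)), coeff_zero_mul_self _ h]
  by_cases hx : (∏ i, bern (v i)).coeff x = 0
  · rw [hx]; simpa using Finset.sum_nonneg fun i _ => sq_nonneg _
  · exact Finset.single_le_sum (f := fun y => ((∏ i, bern (v i)).coeff y) ^ 2)
      (fun i _ => sq_nonneg _) (by simpa using hx)

/-- The numbers `v i`, `i ∈ W`, satisfy no nontrivial integer relation with coefficients bounded
by `K`. -/
def Dissoc {ι : Type*} (v : ι → ℝ) (W : Finset ι) (K : ℝ) : Prop :=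
  ∀ b : ι → ℤ, (∀ i ∈ W, |(b i : ℝ)| ≤ K) → ∑ i ∈ W, (b i : ℝ) * v i = 0 → ∀ i ∈ W, b i = 0

lemma Dissoc.mono {ι : Type*} {v : ι → ℝ} {W : Finset ι} {K K' : ℝ} (h : Dissoc v W K')
    (hK : K ≤ K') : Dissoc v W K :=
  fun b hb => h b fun i hi => (hb i hi).trans hK

/-- If `insert h W` is not dissociated although `W` is, then `v h` is a rational combination
of the `v i` with `i ∈ W`. -/
lemma exists_relation_of_not_dissoc {ι : Type*} {v : ι → ℝ} {W : Finset ι} {K : ℝ} {h : ι}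
    (hh : h ∉ W) (hK : 0 ≤ K) (hW : Dissoc v W K) (hn : ¬ Dissoc v (insert h W) K) :
    ∃ (a : ℤ) (e : ι → ℤ), 0 < a ∧ (a : ℝ) ≤ K ∧ (∀ i, |(e i : ℝ)| ≤ K) ∧
      (a : ℝ) * v h = ∑ i ∈ W, (e i : ℝ) * v i := by
  simp only [Dissoc, not_forall] at hn
  obtain ⟨b, hb, hs, i₀, hi₀, hne⟩ := hn
  rw [Finset.sum_insert hh] at hs
  have hbh : b h ≠ 0 := by
    intro h0
    have hz := hW b (fun i hi => hb i (Finset.mem_insert_of_mem hi)) (by simpa [h0] using hs)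
    rcases Finset.mem_insert.1 hi₀ with rfl | hi
    · exact hne h0
    · exact hne (hz _ hi)
  refine ⟨|b h|, fun i => if i ∈ W then -(b h).sign * b i else 0, abs_pos.2 hbh, ?_, ?_, ?_⟩
  · simpa using hb h (Finset.mem_insert_self _ _)
  · intro i
    by_cases hi : i ∈ W
    · have h1 : |((b h).sign : ℝ)| = 1 := by
        rcases lt_or_gt_of_ne hbh with h2 | h2
        · simp [Int.sign_eq_neg_one_of_neg h2]
        · simp [Int.sign_eq_one_of_pos h2]
      simpa [hi, abs_mul, h1] using hb i (Finset.mem_insert_of_mem hi)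
    · simpa [hi] using hK
  · have h1 : ∑ i ∈ W, (((if i ∈ W then -(b h).sign * b i else 0 : ℤ) : ℤ) : ℝ) * v i
        = -((b h).sign : ℝ) * ∑ i ∈ W, (b i : ℝ) * v i := by
      rw [Finset.mul_sum]
      refine Finset.sum_congr rfl fun i hi => ?_
      rw [if_pos hi]
      push_cast
      ring
    rw [h1, eq_neg_of_add_eq_zero_right hs, ← Int.sign_mul_self_eq_abs]
    push_cast
    ring

/-- Selection of a dissociated set such that almost all `v h` are rational combinations of its
elements at a smaller scale. -/
lemma exists_dissoc_spanning {ι : Type*} [Fintype ι] (v : ι → ℝ) (t : ℕ) (K : ℕ → ℝ)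
    (hK : Monotone K) (hK0 : 2 * 2 ^ t ≤ K 0) (D : ℕ)
    (hp : (1 / √(2 * 2 ^ t + 1)) ^ D < (∏ i, bern (v i) ^ 2).coeff 0) :
    ∃ (W : Finset ι) (r : ℕ) (E : Finset ι), W.card < D ∧ r < D ∧ Dissoc v W (K (r + 1)) ∧
      E.card ≤ 2 ^ t * (D + 1) ∧
      ∀ h, h ∉ E → ∃ (a : ℤ) (e : ι → ℤ), 0 < a ∧ (a : ℝ) ≤ K r ∧ (∀ i, |(e i : ℝ)| ≤ K r) ∧
        (a : ℝ) * v h = ∑ i ∈ W, (e i : ℝ) * v i := by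
  have hK1 : ∀ r, (1 : ℝ) ≤ K r := fun r => by
    have : (1 : ℝ) ≤ 2 ^ t := one_le_pow₀ (by norm_num)
    linarith [hK (Nat.zero_le r)]
  obtain ⟨W, ⟨hW, hWB⟩, hWD, hval, hor⟩ := exists_greedy v t (fun W => Dissoc v W (K (D - W.card)) ∧
      ∀ x, (∏ i ∈ W, bern (v i) ^ (2 * 2 ^ t)).coeff x ≤ (1 / √(2 * 2 ^ t + 1)) ^ W.card)
    ⟨fun b _ _ i hi => absurd hi (Finset.notMem_empty i), fun x => by
      rw [Finset.prod_empty, AddMonoidAlgebra.one_def, AddMonoidAlgebra.coeff_single,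
        Finsupp.single_apply]
      split_ifs <;> simp⟩ D
  have hlt : W.card < D := by
    refine lt_of_le_of_ne hWD fun h => ?_
    have := hval _ hWB
    rw [h] at this
    linarith
  obtain ⟨E, hcount, hE⟩ := hor.resolve_left hlt.ne
  have hr : D - W.card = D - W.card - 1 + 1 := by omega
  have hle : K (D - W.card - 1) ≤ K (D - W.card) := hK (by omega)
  refine ⟨W, D - W.card - 1, E, hlt, by omega, by rwa [← hr], hcount, fun h hh => ?_⟩
  by_cases hhW : h ∈ W
  · refine ⟨1, Pi.single h 1, one_pos, by simpa using hK1 _, fun i => ?_, ?_⟩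
    · by_cases hi : i = h
      · subst hi; simpa using hK1 _
      · simpa [hi] using zero_le_one.trans (hK1 _)
    · simp [Pi.single_apply, hhW]
  · refine exists_relation_of_not_dissoc hhW (zero_le_one.trans (hK1 _)) (hW.mono hle) fun hd => ?_
    refine hh (hE h hhW ?_)
    rw [Finset.card_insert_of_notMem hhW]
    refine ⟨hd.mono (hK (by omega)), fun x => ?_⟩
    refine (coeff_prod_insert_le v _ (2 * 2 ^ t) le_rfl W h hhW _ hWB ?_ x).trans ?_
    · intro b k hb1 hbt hk hs
      have hKle : (2 * 2 ^ t : ℝ) ≤ K (D - W.card - 1) := hK0.trans (hK (Nat.zero_le _))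
      have hz := hd (fun i => if i = h then -b else k i) ?_ ?_ h (Finset.mem_insert_self _ _)
      · rw [if_pos rfl] at hz
        omega
      · intro i _
        split_ifs
        · have : (b : ℝ) ≤ 2 * 2 ^ t := by exact_mod_cast hbt
          simpa using this.trans hKle
        · have : |(k i : ℝ)| ≤ 2 * 2 ^ t := by exact_mod_cast hk i
          exact this.trans hKle
      · rw [Finset.sum_insert hhW, if_pos rfl]
        have : ∑ i ∈ W, (((if i = h then -(b : ℤ) else k i : ℤ)) : ℝ) * v i
            = ∑ i ∈ W, (k i : ℝ) * v i := by
          refine Finset.sum_congr rfl fun i hi => ?_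
          rw [if_neg (ne_of_mem_of_not_mem hi hhW)]
        rw [this, ← hs]
        push_cast
        ring
    · rw [pow_succ]
      push_cast
      exact le_of_eq (by ring)

/-- Selection of a common denominator for almost all of the `v h`. -/
lemma exists_common_denominator {ι : Type*} [Fintype ι] (v : ι → ℝ) (t : ℕ) (W G : Finset ι)
    (K K' S κ : ℝ) (hK : 1 ≤ K) (hW : Dissoc v W K') (a : ι → ℤ) (e : ι → ι → ℤ)
    (ha0 : ∀ h ∈ G, 0 < a h) (haK : ∀ h ∈ G, (a h : ℝ) ≤ K)
    (he : ∀ h ∈ G, ∀ i, |(e h i : ℝ)| ≤ K)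
    (hrel : ∀ h ∈ G, (a h : ℝ) * v h = ∑ i ∈ W, (e h i : ℝ) * v i)
    (hκ0 : 0 < κ) (hκ1 : κ ≤ 1) (hκ : K ^ κ ≤ 2 * 2 ^ t + 1)
    (hS : ∀ s : ℕ, 0 < s → (∏ i, bern (v i) ^ 2).coeff 0 ≤ (s : ℝ) ^ (-κ / 2) → (s : ℝ) ≤ S)
    (hK' : 2 * 2 ^ t * S * K + Fintype.card ι * (2 * 2 ^ t) * S * K ^ 2 ≤ K')
    (D : ℕ) (hD : S < 2 ^ D) :
    ∃ (s : ℕ) (E : Finset ι), 0 < s ∧ (s : ℝ) ≤ S ∧ E.card ≤ 2 ^ t * (D + 1) ∧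
      ∀ h ∈ G, h ∉ E → ∀ i ∈ W, a h ∣ s * e h i := by
  obtain ⟨U, ⟨s, hs0, hUG, hdiv, hUs, hUB⟩, hUD, hval, hor⟩ := exists_greedy v t
    (fun U => ∃ s : ℕ, 0 < s ∧ U ⊆ G ∧ (∀ j ∈ U, ∀ i ∈ W, a j ∣ s * e j i) ∧ 2 ^ U.card ≤ s ∧
      ∀ x, (∏ i ∈ U, bern (v i) ^ (2 * 2 ^ t)).coeff x ≤ (s : ℝ) ^ (-κ / 2))
    ⟨1, one_pos, by simp, by simp, by simp, fun x => by
      rw [Finset.prod_empty, AddMonoidAlgebra.one_def, AddMonoidAlgebra.coeff_single,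
        Finsupp.single_apply]
      split_ifs <;> simp⟩ D
  have hsS : (s : ℝ) ≤ S := hS s hs0 (hval _ hUB)
  have hlt : U.card ≠ D := by
    intro h
    rw [h] at hUs
    have : (2 : ℝ) ^ D ≤ s := by exact_mod_cast hUs
    linarith
  have hs0' : (0 : ℝ) < s := by exact_mod_cast hs0
  have hS0 : 0 ≤ S := hs0'.le.trans hsS
  obtain ⟨E, hcount, hE'⟩ := hor.resolve_left hlt
  refine ⟨s, E, hs0, hsS, hcount, fun h hG hE => ?_⟩
  by_cases hhU : h ∈ U
  · exact hdiv h hhU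
  by_contra hnd
  refine hE (hE' h hhU ?_)
  have hex : ∃ q : ℕ, 0 < q ∧ ∀ i ∈ W, a h ∣ q * (s * e h i) :=
    ⟨(a h).toNat, by have := ha0 h hG; omega, fun i _ => by
      rw [Int.toNat_of_nonneg (ha0 h hG).le]; exact dvd_mul_right _ _⟩
  obtain ⟨q, ⟨hq0, hq⟩, hmin⟩ : ∃ q : ℕ, (0 < q ∧ ∀ i ∈ W, a h ∣ q * (s * e h i)) ∧
      ∀ q', q' < q → ¬ (0 < q' ∧ ∀ i ∈ W, a h ∣ q' * (s * e h i)) :=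
    ⟨Nat.find hex, Nat.find_spec hex, fun _ => Nat.find_min hex⟩
  have hq2 : 2 ≤ q := by
    by_contra hcon
    have : q = 1 := by omega
    subst this
    exact hnd (by simpa using hq)
  have hqK : (q : ℝ) ≤ K := by
    refine le_trans ?_ (haK h hG)
    have : (q : ℤ) ≤ a h := by
      by_contra hcon
      refine hmin (a h).toNat (by have := ha0 h hG; omega) ⟨by have := ha0 h hG; omega, fun i _ => ?_⟩
      rw [Int.toNat_of_nonneg (ha0 h hG).le]; exact dvd_mul_right _ _
    exact_mod_cast this
  refine ⟨q * s, by positivity, Finset.insert_subset hG hUG, ?_, ?_, fun x => ?_⟩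
  · intro j hj i hi
    rcases Finset.mem_insert.1 hj with rfl | hj
    · simpa [mul_assoc] using hq i hi
    · have := (hdiv j hj i hi).mul_left q
      simpa [mul_assoc] using this
  · rw [Finset.card_insert_of_notMem hhU, pow_succ, mul_comm]
    exact Nat.mul_le_mul hq2 hUs
  refine (coeff_prod_insert_le v _ (min (q - 1) (2 * 2 ^ t)) (min_le_right _ _) U h hhU _ hUB ?_
    x).trans ?_
  · intro b k hb1 hbt hk hs
    have hbq : b < q := by have := hbt.trans (min_le_left _ _); omega
    have hbm : (b : ℝ) ≤ 2 * 2 ^ t := by exact_mod_cast hbt.trans (min_le_right _ _)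
    have hf : ∀ j ∈ U, ∀ i ∈ W, (s : ℝ) * e j i = a j * ((s * e j i / a j : ℤ) : ℝ) := by
      intro j hj i hi
      exact_mod_cast (Int.mul_ediv_cancel' (hdiv j hj i hi)).symm
    have hfK : ∀ j ∈ U, ∀ i ∈ W, |((s * e j i / a j : ℤ) : ℝ)| ≤ S * K := by
      intro j hj i hi
      have h1 : (1 : ℝ) ≤ a j := by exact_mod_cast ha0 j (hUG hj)
      have h2 := congrArg abs (hf j hj i hi)
      rw [abs_mul, abs_mul, abs_of_nonneg hs0'.le, abs_of_nonneg (zero_le_one.trans h1)] at h2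
      calc _ ≤ (a j : ℝ) * |((s * e j i / a j : ℤ) : ℝ)| := le_mul_of_one_le_left (abs_nonneg _) h1
        _ = _ := h2.symm
        _ ≤ _ := mul_le_mul hsS (he j (hUG hj) i) (abs_nonneg _) (hs0'.le.trans hsS)
    have hz := hW (fun i => b * (s * e h i) - a h * ∑ j ∈ U, k j * (s * e j i / a j)) ?_ ?_
    · refine hmin b hbq ⟨hb1, fun i hi =>
        ⟨∑ j ∈ U, k j * (s * e j i / a j), ?_⟩⟩
      exact sub_eq_zero.1 (hz i hi)
    · intro i hi
      push_cast
      refine le_trans (abs_sub _ _) (le_trans (add_le_add ?_ ?_) hK')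
      · rw [abs_mul, abs_mul, Nat.abs_cast, Nat.abs_cast]
        calc _ ≤ 2 * 2 ^ t * (S * K) := by
              gcongr
              exact he h hG i
          _ = _ := by ring
      · rw [abs_mul]
        calc _ ≤ K * (Fintype.card ι * (2 * 2 ^ t * (S * K))) := by
              have ha := ha0 h hG
              have ha' : (0 : ℝ) < a h := by exact_mod_cast ha
              refine mul_le_mul ?_ ?_ (abs_nonneg _) (by linarith)
              · rw [abs_of_pos ha']; exact haK h hG
              · refine (Finset.abs_sum_le_sum_abs _ _).trans ?_
                calc _ ≤ ∑ j ∈ U, (2 * 2 ^ t * (S * K)) := by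
                      refine Finset.sum_le_sum fun j hj => ?_
                      rw [abs_mul]
                      refine mul_le_mul ?_ (hfK j hj i hi) (abs_nonneg _) (by positivity)
                      exact_mod_cast hk j
                  _ = U.card * (2 * 2 ^ t * (S * K)) := by rw [Finset.sum_const, nsmul_eq_mul]
                  _ ≤ _ := by
                      gcongr
                      exact Finset.card_le_univ U
          _ = _ := by ring
    · have hv : ∀ j ∈ U, ∑ i ∈ W, ((s * e j i / a j : ℤ) : ℝ) * v i = s * v j := by
        intro j hj
        have h1 : (a j : ℝ) ≠ 0 := by exact_mod_cast (ha0 j (hUG hj)).ne'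
        refine mul_left_cancel₀ h1 ?_
        rw [mul_left_comm, hrel j (hUG hj), Finset.mul_sum, Finset.mul_sum]
        refine Finset.sum_congr rfl fun i hi => ?_
        rw [← mul_assoc, ← hf j hj i hi, mul_assoc]
      have h2 : ∑ i ∈ W, (∑ j ∈ U, (k j : ℝ) * ((s * e j i / a j : ℤ) : ℝ)) * v i
          = s * ∑ j ∈ U, (k j : ℝ) * v j := by
        simp only [Finset.sum_mul]
        rw [Finset.sum_comm, Finset.mul_sum]
        refine Finset.sum_congr rfl fun j hj => ?_
        simp only [mul_assoc]
        rw [← Finset.mul_sum, hv j hj]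
        ring
      have h3 : ∀ i ∈ W, (((b * (s * e h i) - a h * ∑ j ∈ U, k j * (s * e j i / a j) : ℤ)) : ℝ) * v i
          = b * s * (e h i * v i)
            - a h * ((∑ j ∈ U, (k j : ℝ) * ((s * e j i / a j : ℤ) : ℝ)) * v i) := by
        intro i _
        push_cast
        ring
      rw [Finset.sum_congr rfl h3, Finset.sum_sub_distrib, ← Finset.mul_sum, ← Finset.mul_sum, h2,
        ← hrel h hG, ← hs]
      ring
  · have hq0' : (0 : ℝ) < q := by exact_mod_cast hq0
    have h1 : (q : ℝ) ^ κ ≤ ((min (q - 1) (2 * 2 ^ t) : ℕ) : ℝ) + 1 := by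
      push_cast [show 1 ≤ q from hq0]
      rw [← min_add_add_right, le_min_iff]
      constructor
      · rw [sub_add_cancel]
        calc (q : ℝ) ^ κ ≤ (q : ℝ) ^ (1 : ℝ) :=
              Real.rpow_le_rpow_of_exponent_le (by exact_mod_cast hq0) hκ1
          _ = q := Real.rpow_one _
      · exact (Real.rpow_le_rpow hq0'.le hqK hκ0.le).trans hκ
    have h2 : (q : ℝ) ^ (κ / 2) ≤ √((min (q - 1) (2 * 2 ^ t) : ℕ) + 1) := by
      refine Real.le_sqrt_of_sq_le ?_
      rw [← Real.rpow_natCast, ← Real.rpow_mul hq0'.le]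
      simpa using h1
    have h3 : ((q * s : ℕ) : ℝ) ^ (-κ / 2) = (s : ℝ) ^ (-κ / 2) / (q : ℝ) ^ (κ / 2) := by
      rw [Nat.cast_mul, Real.mul_rpow hq0'.le hs0'.le, mul_comm, neg_div, Real.rpow_neg hq0'.le,
        ← div_eq_mul_inv]
    rw [h3]
    exact div_le_div_of_nonneg_left (by positivity) (by positivity) h2

/-- The exponents of the scales used in the selection of a dissociated set. -/
def scaleExp (ε B : ℝ) : ℕ → ℝ
  | 0 => 2
  | r + 1 => 4 + 4 * B * scaleExp ε B r / ε + 2 * scaleExp ε B r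

lemma two_le_scaleExp {ε B : ℝ} (hε : 0 < ε) (hB : 0 < B) (r : ℕ) : 2 ≤ scaleExp ε B r := by
  induction r with
  | zero => exact le_rfl
  | succ r ih =>
    have : 0 ≤ 4 * B * scaleExp ε B r / ε := by positivity
    rw [scaleExp]
    linarith

lemma monotone_scaleExp {ε B : ℝ} (hε : 0 < ε) (hB : 0 < B) : Monotone (scaleExp ε B) := by
  refine monotone_nat_of_le_succ fun r => ?_
  have h := two_le_scaleExp hε hB r
  have : 0 ≤ 4 * B * scaleExp ε B r / ε := by positivity
  rw [scaleExp]
  linarith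

/-- Inverse Littlewood-Offord theorem with explicit largeness assumptions. -/
lemma exists_spanning_of_coeff_ge {n : ℕ} (hn : 2 ≤ n) {ε B : ℝ} (hε0 : 0 < ε) (hε1 : ε < 1)
    (hB : 0 < B) (D : ℕ) (hD : 4 * B / ε < D)
    (hexp : (n : ℝ) ^ (4 * B * scaleExp ε B D / ε) < 2 ^ ((n : ℝ) ^ (ε / 2) / 2))
    (v : Fin n → ℝ) (hp : (n : ℝ) ^ (-B) ≤ (∏ i, bern (v i) ^ 2).coeff 0) :
    ∃ (W E : Finset (Fin n)) (s : ℕ), 0 < s ∧ (s : ℝ) ≤ (n : ℝ) ^ scaleExp ε B D ∧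
      W.card ≤ D ∧ (E.card : ℝ) ≤ (D + 3) * (n : ℝ) ^ ε ∧
      ∀ h, h ∉ E → ∃ k : Fin n → ℤ, (∀ i, |(k i : ℝ)| ≤ (n : ℝ) ^ scaleExp ε B D) ∧
        (s : ℝ) * v h = ∑ i ∈ W, (k i : ℝ) * v i := by
  have hn2 : (2 : ℝ) ≤ n := by exact_mod_cast hn
  have hn1 : (1 : ℝ) ≤ n := by linarith
  have hn0 : (0 : ℝ) < n := by linarith
  have hx1 : 1 ≤ (n : ℝ) ^ (ε / 2) := Real.one_le_rpow hn1 (by positivity)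
  obtain ⟨t, ht1, ht2⟩ := exists_nat_pow_near hx1 (one_lt_two : (1 : ℝ) < 2)
  rw [pow_succ] at ht2
  have hxn : (n : ℝ) ^ (ε / 2) ≤ n := by
    calc (n : ℝ) ^ (ε / 2) ≤ (n : ℝ) ^ (1 : ℝ) := Real.rpow_le_rpow_of_exponent_le hn1 (by linarith)
      _ = n := Real.rpow_one _
  have h2t : (2 * 2 ^ t : ℝ) ≤ (n : ℝ) ^ (2 : ℝ) := by
    rw [Real.rpow_two, sq]
    exact mul_le_mul hn2 (ht1.trans hxn) (by positivity) hn0.le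
  have hD0 : 0 < D := by
    have : 0 < 4 * B / ε := by positivity
    exact_mod_cast this.trans hD
  have hpow : (1 / √(2 * 2 ^ t + 1)) ^ D < (∏ i, bern (v i) ^ 2).coeff 0 := by
    refine lt_of_lt_of_le ?_ hp
    have h1 : (n : ℝ) ^ (ε / 4) < √(2 * 2 ^ t + 1) := by
      refine Real.lt_sqrt_of_sq_lt ?_
      rw [← Real.rpow_natCast, ← Real.rpow_mul hn0.le]
      have : ε / 4 * ((2 : ℕ) : ℝ) = ε / 2 := by push_cast; ring
      rw [this]
      linarith
    calc (1 / √(2 * 2 ^ t + 1)) ^ D < (1 / (n : ℝ) ^ (ε / 4)) ^ D := by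
          have : (0 : ℝ) < n ^ (ε / 4) := by positivity
          gcongr
      _ = (n : ℝ) ^ (-(ε / 4 * D)) := by
          rw [one_div, ← Real.rpow_neg hn0.le, ← Real.rpow_natCast, ← Real.rpow_mul hn0.le]
          ring_nf
      _ ≤ (n : ℝ) ^ (-B) := by
          refine Real.rpow_le_rpow_of_exponent_le hn1 ?_
          rw [div_lt_iff₀ hε0] at hD
          linarith
  obtain ⟨W, r, E₁, hWD, hrD, hW, hE₁, hrel⟩ := exists_dissoc_spanning v t
    (fun r => (n : ℝ) ^ scaleExp ε B r)
    (fun _ _ h => Real.rpow_le_rpow_of_exponent_le hn1 (monotone_scaleExp hε0 hB h)) h2t D hpow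
  choose! a e ha0 haK he hrel using hrel
  have he2 := two_le_scaleExp hε0 hB r
  have heD : scaleExp ε B (r + 1) ≤ scaleExp ε B D := monotone_scaleExp hε0 hB hrD
  have heD' : scaleExp ε B r ≤ scaleExp ε B D := monotone_scaleExp hε0 hB hrD.le
  set K : ℝ := (n : ℝ) ^ scaleExp ε B r with hKdef
  set S : ℝ := (n : ℝ) ^ (4 * B * scaleExp ε B r / ε) with hSdef
  have hK1 : 1 ≤ K := Real.one_le_rpow hn1 (by linarith)
  have hS1 : 1 ≤ S := Real.one_le_rpow hn1 (by positivity)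
  have hK' : (n : ℝ) ^ scaleExp ε B (r + 1) = (n : ℝ) ^ (4 : ℕ) * S * K ^ 2 := by
    rw [scaleExp, Real.rpow_add hn0, Real.rpow_add hn0, ← Real.rpow_natCast, ← Real.rpow_natCast,
      hKdef, ← Real.rpow_mul hn0.le, ← hSdef]
    push_cast
    ring_nf
  have hSK : S * K ≤ (n : ℝ) ^ scaleExp ε B D := by
    calc S * K ≤ (n : ℝ) ^ (4 : ℕ) * S * K ^ 2 := by
          have h1 : (1 : ℝ) ≤ (n : ℝ) ^ (4 : ℕ) := one_le_pow₀ hn1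
          have h2 : K ≤ K ^ 2 := le_self_pow₀ hK1 two_ne_zero
          exact mul_le_mul (le_mul_of_one_le_left (by linarith) h1) h2 (by linarith) (by positivity)
      _ = _ := hK'.symm
      _ ≤ _ := Real.rpow_le_rpow_of_exponent_le hn1 heD
  obtain ⟨s, E₂, hs0, hsS, hE₂, hdiv⟩ := exists_common_denominator v t W E₁ᶜ K
    ((n : ℝ) ^ scaleExp ε B (r + 1)) S (ε / (2 * scaleExp ε B r)) hK1 hW a e
    (fun h hh => ha0 h (Finset.mem_compl.1 hh)) (fun h hh => haK h (Finset.mem_compl.1 hh))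
    (fun h hh => he h (Finset.mem_compl.1 hh)) (fun h hh => hrel h (Finset.mem_compl.1 hh))
    (by positivity) (by rw [div_le_one (by positivity)]; linarith)
    (by
      rw [hKdef, ← Real.rpow_mul hn0.le]
      have : scaleExp ε B r * (ε / (2 * scaleExp ε B r)) = ε / 2 := by field_simp
      rw [this]
      linarith)
    (by
      intro s hs hle
      have hs' : (0 : ℝ) < s := by exact_mod_cast hs
      have h1 := hp.trans hle
      have h2 : (s : ℝ) ^ (ε / (4 * scaleExp ε B r)) ≤ (n : ℝ) ^ B := by
        rw [← inv_le_inv₀ (by positivity) (by positivity), ← Real.rpow_neg hn0.le,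
          ← Real.rpow_neg hs'.le]
        convert h1 using 2
        field_simp
        ring
      have h3 := Real.rpow_le_rpow (by positivity) h2
        (show 0 ≤ 4 * scaleExp ε B r / ε by positivity)
      rw [← Real.rpow_mul hs'.le, ← Real.rpow_mul hn0.le] at h3
      have h4 : ε / (4 * scaleExp ε B r) * (4 * scaleExp ε B r / ε) = 1 := by field_simp
      rw [h4, Real.rpow_one] at h3
      refine h3.trans_eq ?_
      rw [hSdef]
      ring_nf)
    (by
      have h3 : K ≤ K ^ 2 := le_self_pow₀ hK1 two_ne_zero
      have h5 : (2 * 2 ^ t : ℝ) ≤ n ^ 2 := by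
        rwa [Real.rpow_two] at h2t
      have h6 : (n : ℝ) ^ 2 + n * n ^ 2 ≤ n ^ 4 := by
        nlinarith [mul_nonneg (mul_nonneg hn0.le hn0.le) (mul_nonneg (sub_nonneg.2 hn2)
          (by linarith : (0 : ℝ) ≤ n + 1))]
      rw [hK', Fintype.card_fin]
      calc _ ≤ n ^ 2 * S * K ^ 2 + n * n ^ 2 * S * K ^ 2 := by gcongr
        _ = (n ^ 2 + n * n ^ 2) * S * K ^ 2 := by ring
        _ ≤ _ := by gcongr)
    (2 ^ t)
    (by
      calc S ≤ (n : ℝ) ^ (4 * B * scaleExp ε B D / ε) := by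
            refine Real.rpow_le_rpow_of_exponent_le hn1 ?_
            gcongr
        _ < 2 ^ ((n : ℝ) ^ (ε / 2) / 2) := hexp
        _ ≤ (2 : ℝ) ^ (((2 ^ t : ℕ) : ℕ) : ℝ) := by
            refine Real.rpow_le_rpow_of_exponent_le one_le_two ?_
            push_cast
            linarith
        _ = _ := Real.rpow_natCast _ _)
  refine ⟨W, E₁ ∪ E₂, s, hs0, hsS.trans ((le_mul_of_one_le_right (by linarith) hK1).trans hSK),
    hWD.le, ?_, fun h hh => ?_⟩
  · have h1 : ((E₁ ∪ E₂).card : ℝ) ≤ 2 ^ t * (D + 1) + 2 ^ t * (2 ^ t + 1) := by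
      exact_mod_cast (Finset.card_union_le _ _).trans (add_le_add hE₁ hE₂)
    have h2 : (n : ℝ) ^ ε = n ^ (ε / 2) * n ^ (ε / 2) := by
      rw [← Real.rpow_add hn0]; ring_nf
    rw [h2]
    have h3 : (2 ^ t : ℝ) ≤ n ^ (ε / 2) * n ^ (ε / 2) := by nlinarith
    have h4 : (2 ^ t * 2 ^ t : ℝ) ≤ n ^ (ε / 2) * n ^ (ε / 2) := by gcongr
    nlinarith [mul_le_mul_of_nonneg_right h3 (Nat.cast_nonneg D : (0 : ℝ) ≤ D)]
  · rw [Finset.mem_union, not_or] at hh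
    have ha := ha0 h hh.1
    have ha1 : (1 : ℝ) ≤ a h := by exact_mod_cast ha
    have hf : ∀ i ∈ W, (s : ℝ) * e h i = a h * ((s * e h i / a h : ℤ) : ℝ) := by
      intro i hi
      exact_mod_cast (Int.mul_ediv_cancel' (hdiv h (Finset.mem_compl.2 hh.1) hh.2 i hi)).symm
    refine ⟨fun i => if i ∈ W then s * e h i / a h else 0, fun i => ?_, ?_⟩
    · by_cases hi : i ∈ W
      · simp only [hi, if_true]
        have h2 := congrArg abs (hf i hi)
        rw [abs_mul, abs_mul, Nat.abs_cast, abs_of_nonneg (zero_le_one.trans ha1)] at h2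
        calc _ ≤ (a h : ℝ) * |((s * e h i / a h : ℤ) : ℝ)| :=
              le_mul_of_one_le_left (abs_nonneg _) ha1
          _ = _ := h2.symm
          _ ≤ S * K := mul_le_mul hsS (he h hh.1 i) (abs_nonneg _) (by linarith)
          _ ≤ _ := hSK
      · simp only [hi, if_false, Int.cast_zero, abs_zero]
        positivity
    · refine mul_left_cancel₀ (zero_lt_one.trans_le ha1).ne' ?_
      rw [mul_left_comm, hrel h hh.1, Finset.mul_sum, Finset.mul_sum]
      refine Finset.sum_congr rfl fun i hi => ?_
      simp only [hi, if_true]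
      rw [← mul_assoc, ← mul_assoc, hf i hi]

lemma eventually_rpow_lt_two_rpow (P : ℝ) {ε : ℝ} (hε : 0 < ε) :
    ∀ᶠ n : ℕ in Filter.atTop, (n : ℝ) ^ P < 2 ^ ((n : ℝ) ^ (ε / 2) / 2) := by
  have h1 := (isLittleO_rpow_exp_pos_mul_atTop (2 * P / ε)
    (show 0 < Real.log 2 / 2 by have := Real.log_pos one_lt_two; positivity)).bound
    (show (0 : ℝ) < 1 / 2 by norm_num)
  have h2 : Filter.Tendsto (fun n : ℕ => (n : ℝ) ^ (ε / 2)) Filter.atTop Filter.atTop :=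
    (tendsto_rpow_atTop (by positivity)).comp tendsto_natCast_atTop_atTop
  filter_upwards [h2.eventually h1] with n hn
  rw [← Real.rpow_mul (Nat.cast_nonneg n), Real.norm_of_nonneg (by positivity),
    Real.norm_of_nonneg (by positivity)] at hn
  have h3 : ε / 2 * (2 * P / ε) = P := by field_simp
  have h4 : Real.log 2 / 2 * (n : ℝ) ^ (ε / 2) = Real.log 2 * ((n : ℝ) ^ (ε / 2) / 2) := by ring
  rw [h3, h4, ← Real.rpow_def_of_pos two_pos] at hn
  have : (0 : ℝ) < 2 ^ ((n : ℝ) ^ (ε / 2) / 2) := by positivity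
  linarith

/-- Inverse Littlewood-Offord theorem for linear forms: if a signed sum of the `v i` is
concentrated at a point, then almost all `v h` are rational combinations, of small height, of
boundedly many of them. -/
lemma exists_spanning_of_concentrated (ε A : ℝ) (hε0 : 0 < ε) (hε1 : ε < 1) (hA : 0 < A) :
    ∃ (D : ℕ) (c : ℝ), 0 < c ∧ ∀ᶠ n : ℕ in Filter.atTop, ∀ (v : Fin n → ℝ) (a : ℝ),
      (n : ℝ) ^ (-A) ≤ ((Finset.univ.filter fun s : Fin n → Bool =>
        ∑ i, v i * signv (s i) = a).card : ℝ) / 2 ^ n →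
      ∃ (W E : Finset (Fin n)) (s : ℕ), 0 < s ∧ (s : ℝ) ≤ (n : ℝ) ^ c ∧ W.card ≤ D ∧
        (E.card : ℝ) ≤ c * (n : ℝ) ^ ε ∧
        ∀ h, h ∉ E → ∃ k : Fin n → ℤ, (∀ i, |(k i : ℝ)| ≤ (n : ℝ) ^ c) ∧
          (s : ℝ) * v h = ∑ i ∈ W, (k i : ℝ) * v i := by
  obtain ⟨D, hD⟩ := exists_nat_gt (4 * (2 * A) / ε)
  have he := two_le_scaleExp hε0 (show 0 < 2 * A by positivity) D
  refine ⟨D, scaleExp ε (2 * A) D + (D + 3), by positivity, ?_⟩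
  filter_upwards [eventually_rpow_lt_two_rpow (4 * (2 * A) * scaleExp ε (2 * A) D / ε) hε0,
    Filter.eventually_ge_atTop 2] with n hexp hn v a hp
  have hn1 : (1 : ℝ) ≤ n := by exact_mod_cast (by omega : 1 ≤ n)
  have hp : (n : ℝ) ^ (-A) ≤ (∏ i, bern (v i)).coeff a := by
    rw [coeff_prod_bern, Fintype.card_fin]
    convert hp
  have hp2 : (n : ℝ) ^ (-(2 * A)) ≤ (∏ i, bern (v i) ^ 2).coeff 0 := by
    refine le_trans ?_ (sq_le_coeff_zero_prod v a)
    refine le_trans (le_of_eq ?_) (pow_le_pow_left₀ (by positivity) hp 2)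
    rw [← Real.rpow_natCast, ← Real.rpow_mul (by positivity)]
    push_cast
    ring_nf
  obtain ⟨W, E, s, hs0, hs, hW, hE, h⟩ :=
    exists_spanning_of_coeff_ge hn hε0 hε1 (by positivity) D hD hexp v hp2
  have hc : (n : ℝ) ^ scaleExp ε (2 * A) D ≤ (n : ℝ) ^ (scaleExp ε (2 * A) D + (D + 3)) :=
    Real.rpow_le_rpow_of_exponent_le hn1 (by linarith [(Nat.cast_nonneg D : (0 : ℝ) ≤ D)])
  refine ⟨W, E, s, hs0, hs.trans hc, hW, hE.trans ?_, fun i hi => ?_⟩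
  · exact mul_le_mul_of_nonneg_right (by linarith) (by positivity)
  · obtain ⟨k, hk, hrel⟩ := h i hi
    exact ⟨k, fun j => (hk j).trans hc, hrel⟩

lemma IsProperSymGAPSet.mono {Q : Set ℝ} {r r' : ℕ} {s s' : ℝ} (h : IsProperSymGAPSet Q r s)
    (hr : r ≤ r') (hs : s ≤ s') : IsProperSymGAPSet Q r' s' := by
  obtain ⟨d, g, N, hd, hQ, hinj, hN⟩ := h
  exact ⟨d, g, N, hd.trans hr, hQ, hinj, hN.trans hs⟩

/-- A symmetric GAP is contained in a proper symmetric GAP of at most the same rank and of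
polynomially bounded size. -/
lemma exists_proper_gap (d : ℕ) : ∀ (N : ℕ), 1 ≤ N → ∀ g : Fin d → ℝ, ∃ Q : Set ℝ,
    IsProperSymGAPSet Q d ((4 * N : ℝ) ^ (d * 2 ^ d)) ∧
      ∀ m : Fin d → ℤ, (∀ i, |m i| ≤ (N : ℤ)) → ∑ i, (m i : ℝ) * g i ∈ Q := by
  induction d with
  | zero =>
    intro N _ g
    refine ⟨{0}, ⟨0, g, fun _ => N, le_rfl, ?_, fun m m' _ _ _ => Subsingleton.elim _ _, ?_⟩,
      fun m _ => by simp⟩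
    · ext x; simp
    · simp
  | succ d ih =>
    intro N hN g
    have hN1 : (1 : ℝ) ≤ N := by exact_mod_cast hN
    by_cases hinj : ∀ m m' : Fin (d + 1) → ℤ, (∀ i, |m i| ≤ (N : ℤ)) → (∀ i, |m' i| ≤ (N : ℤ)) →
      (∑ i, (m i : ℝ) * g i) = (∑ i, (m' i : ℝ) * g i) → m = m'
    · refine ⟨_, ⟨d + 1, g, fun _ => N, le_rfl, rfl, hinj, ?_⟩, fun m hm => ⟨m, hm, rfl⟩⟩
      rw [Finset.prod_const, Finset.card_univ, Fintype.card_fin]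
      calc (2 * (N : ℝ) + 1) ^ (d + 1) ≤ (4 * N : ℝ) ^ (d + 1) := by gcongr; linarith
        _ ≤ _ := pow_le_pow_right₀ (by linarith) (Nat.le_mul_of_pos_right _ (by positivity))
    · push Not at hinj
      obtain ⟨p, p', hp, hp', heq, hne⟩ := hinj
      obtain ⟨z, hz⟩ := Function.ne_iff.1 hne
      have hb : ∀ i, |p i - p' i| ≤ 2 * N := fun i =>
        (abs_sub _ _).trans (by linarith [hp i, hp' i])
      have hz0 : ((p z - p' z : ℤ) : ℝ) ≠ 0 := by exact_mod_cast sub_ne_zero.2 hz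
      obtain ⟨Q, hQ, hmem⟩ := ih (4 * N ^ 2) (by nlinarith [Nat.pow_le_pow_left hN 2])
        (fun i => g (z.succAbove i) / ((p z - p' z : ℤ) : ℝ))
      refine ⟨Q, hQ.mono (Nat.le_succ d) ?_, fun m hm => ?_⟩
      · have : (4 * ((4 * N ^ 2 : ℕ) : ℝ)) = (4 * N : ℝ) ^ 2 := by push_cast; ring
        rw [this, ← pow_mul]
        refine pow_le_pow_right₀ (by linarith) ?_
        rw [pow_succ 2 d]
        nlinarith [Nat.zero_le (2 ^ d)]
      · have hx := hmem (fun i => m (z.succAbove i) * (p z - p' z)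
          - m z * (p (z.succAbove i) - p' (z.succAbove i))) fun i => by
            refine (abs_sub _ _).trans ?_
            rw [abs_mul, abs_mul]
            have h1 := mul_le_mul (hm (z.succAbove i)) (hb z) (abs_nonneg _) (by positivity)
            have h2 := mul_le_mul (hm z) (hb (z.succAbove i)) (abs_nonneg _) (by positivity)
            push_cast
            linarith
        convert hx using 1
        have hrel : ∑ i, ((p i - p' i : ℤ) : ℝ) * g i = 0 := by
          simp only [Int.cast_sub, sub_mul, Finset.sum_sub_distrib]
          exact sub_eq_zero.2 heq
        rw [Fin.sum_univ_succAbove _ z] at hrel ⊢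
        refine mul_left_cancel₀ hz0 ?_
        rw [mul_add, mul_left_comm, eq_neg_of_add_eq_zero_left hrel, Finset.mul_sum,
          Finset.mul_sum, mul_neg, Finset.mul_sum, ← Finset.sum_neg_distrib,
          ← Finset.sum_add_distrib]
        refine Finset.sum_congr rfl fun i _ => ?_
        push_cast at hz0 ⊢
        field_simp
        ring

/-- Integer combinations of boundedly many reals with bounded coefficients lie in a proper
symmetric GAP of bounded rank. -/
lemma exists_proper_gap_of_finset {ι : Type*} (W : Finset ι) (g : ι → ℝ) (N : ℕ) (hN : 1 ≤ N) :
    ∃ Q : Set ℝ, IsProperSymGAPSet Q W.card ((4 * N : ℝ) ^ (W.card * 2 ^ W.card)) ∧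
      ∀ m : ι → ℤ, (∀ i, |m i| ≤ (N : ℤ)) → ∑ i ∈ W, (m i : ℝ) * g i ∈ Q := by
  obtain ⟨Q, hQ, hmem⟩ := exists_proper_gap W.card N hN fun i => g (W.equivFin.symm i)
  refine ⟨Q, hQ, fun m hm => ?_⟩
  have := hmem (fun i => m (W.equivFin.symm i)) fun i => hm _
  rwa [W.equivFin.symm.sum_comp (fun w : W => (m w : ℝ) * g w),
    Finset.sum_coe_sort W (fun w => (m w : ℝ) * g w)] at this

lemma card_filter_card_le (n D : ℕ) :
    (Finset.univ.filter fun W : Finset (Fin n) => W.card ≤ D).card ≤ (n + 1) ^ D := by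
  have hsub : (Finset.univ.filter fun W : Finset (Fin n) => W.card ≤ D) ⊆
      Finset.univ.image fun f : Fin D → Option (Fin n) =>
        Finset.univ.filter fun i => ∃ j, f j = some i := by
    intro W hW
    rw [Finset.mem_filter] at hW
    refine Finset.mem_image.2 ⟨fun j => W.toList[j.1]?, Finset.mem_univ _, ?_⟩
    ext i
    rw [Finset.mem_filter, ← Finset.mem_toList (s := W), List.mem_iff_getElem?]
    constructor
    · rintro ⟨-, j, hj⟩
      exact ⟨j, hj⟩
    · rintro ⟨j, hj⟩
      have hlt := (List.getElem?_eq_some_iff.1 hj).1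
      rw [Finset.length_toList] at hlt
      exact ⟨Finset.mem_univ _, ⟨j, hlt.trans_le hW.2⟩, hj⟩
  calc _ ≤ _ := Finset.card_le_card hsub
    _ ≤ _ := Finset.card_image_le
    _ = _ := by simp

/-- A dense subset of a product has many dense fibres. -/
lemma le_card_dense_fibers {X Y : Type*} [Fintype X] [Fintype Y] [Nonempty X]
    (P : X → Y → Prop) (δ : ℝ)
    (h : 2 * δ * (Fintype.card X * Fintype.card Y) ≤
      ((Finset.univ.filter fun xy : X × Y => P xy.1 xy.2).card : ℝ)) :
    δ * Fintype.card Y ≤ ((Finset.univ.filter fun y => δ * Fintype.card X ≤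
      ((Finset.univ.filter fun x => P x y).card : ℝ)).card : ℝ) := by
  set G := Finset.univ.filter fun y => δ * Fintype.card X ≤
      ((Finset.univ.filter fun x => P x y).card : ℝ) with hG
  have hX : (0 : ℝ) < Fintype.card X := by exact_mod_cast Fintype.card_pos
  have h1 : ((Finset.univ.filter fun xy : X × Y => P xy.1 xy.2).card : ℝ) =
      ∑ y, ((Finset.univ.filter fun x => P x y).card : ℝ) := by
    simp only [Finset.card_filter]
    rw [Fintype.sum_prod_type_right]
    push_cast
    rfl
  have h2 : ∀ y, ((Finset.univ.filter fun x => P x y).card : ℝ) ≤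
      (if y ∈ G then (Fintype.card X : ℝ) else 0) + max δ 0 * Fintype.card X := by
    intro y
    split_ifs with hy
    · have h3 : ((Finset.univ.filter fun x => P x y).card : ℝ) ≤ Fintype.card X := by
        exact_mod_cast Finset.card_le_univ _
      have : 0 ≤ max δ 0 * Fintype.card X := by positivity
      linarith
    · simp only [hG, Finset.mem_filter, Finset.mem_univ, true_and, not_le] at hy
      rw [zero_add]
      exact hy.le.trans (mul_le_mul_of_nonneg_right (le_max_left _ _) hX.le)
  rcases le_total δ 0 with hδ | hδ
  · exact (mul_nonpos_of_nonpos_of_nonneg hδ (Nat.cast_nonneg _)).trans (Nat.cast_nonneg _)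
  rw [h1] at h
  have h4 := h.trans (Finset.sum_le_sum fun y _ => h2 y)
  rw [Finset.sum_add_distrib, Finset.sum_ite_mem, Finset.univ_inter, Finset.sum_const,
    Finset.sum_const, nsmul_eq_mul, nsmul_eq_mul, Finset.card_univ, max_eq_left hδ] at h4
  refine le_of_mul_le_mul_right ?_ hX
  linarith

/-- If all the sets `E y` are small, then few elements belong to more than half of them. -/
lemma card_often_mem_le {ι Y : Type*} [Fintype ι] (S : Finset Y) (hS : S.Nonempty)
    (E : Y → Finset ι) (M : ℝ) (hE : ∀ y ∈ S, ((E y).card : ℝ) ≤ M) :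
    ((Finset.univ.filter fun i => S.card < 2 * (S.filter fun y => i ∈ E y).card).card : ℝ)
      ≤ 2 * M := by
  set B := Finset.univ.filter fun i => S.card < 2 * (S.filter fun y => i ∈ E y).card with hB
  have hS0 : (0 : ℝ) < S.card := by exact_mod_cast hS.card_pos
  refine le_of_mul_le_mul_right ?_ hS0
  calc (B.card : ℝ) * S.card = ∑ i ∈ B, (S.card : ℝ) := by rw [Finset.sum_const, nsmul_eq_mul]
    _ ≤ ∑ i ∈ B, 2 * ((S.filter fun y => i ∈ E y).card : ℝ) := by
        refine Finset.sum_le_sum fun i hi => ?_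
        exact_mod_cast (Finset.mem_filter.1 hi).2.le
    _ = 2 * ∑ y ∈ S, ((B.filter fun i => i ∈ E y).card : ℝ) := by
        rw [← Finset.mul_sum]
        simp only [Finset.card_filter, Nat.cast_sum]
        rw [Finset.sum_comm]
    _ ≤ 2 * ∑ y ∈ S, M := by
        gcongr with y hy
        refine le_trans ?_ (hE y hy)
        exact_mod_cast Finset.card_le_card fun i hi => (Finset.mem_filter.1 hi).2
    _ = 2 * M * S.card := by rw [Finset.sum_const, nsmul_eq_mul]; ring

/-- If the bilinear form is concentrated at a point, then for many `y` the linear form obtained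
by fixing `y` is concentrated at a point. -/
lemma exists_many_concentrated {n : ℕ} (hn : 4 ≤ n) (C : ℝ) (A : Matrix (Fin n) (Fin n) ℝ)
    (h : (n : ℝ) ^ (-C) ≤ rhoB n A) :
    ∃ a : ℝ, (n : ℝ) ^ (-(C + 1)) * 2 ^ n ≤
      ((Finset.univ.filter fun y : Fin n → Bool => (n : ℝ) ^ (-(C + 1)) ≤
        ((Finset.univ.filter fun x : Fin n → Bool =>
          ∑ i, (∑ j, A i j * signv (y j)) * signv (x i) = a).card : ℝ) / 2 ^ n).card : ℝ) := by
  have hn4 : (4 : ℝ) ≤ n := by exact_mod_cast hn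
  have hn0 : (0 : ℝ) < n := by linarith
  have hpos : (0 : ℝ) < (n : ℝ) ^ (-C) := by positivity
  have hlt : (n : ℝ) ^ (-C) / 2 < rhoB n A := by linarith
  obtain ⟨a, ha⟩ := exists_lt_of_lt_ciSup hlt
  have hδ : 4 * (n : ℝ) ^ (-(C + 1)) ≤ (n : ℝ) ^ (-C) := by
    have h1 : (n : ℝ) ^ (-C) = n * (n : ℝ) ^ (-(C + 1)) := by
      rw [show -C = 1 + -(C + 1) by ring, Real.rpow_add hn0, Real.rpow_one]
    rw [h1]
    gcongr
  refine ⟨a, ?_⟩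
  have := le_card_dense_fibers (X := Fin n → Bool) (Y := Fin n → Bool)
    (fun x y => ∑ i, (∑ j, A i j * signv (y j)) * signv (x i) = a) ((n : ℝ) ^ (-(C + 1))) ?_
  · simp only [Fintype.card_pi, Fintype.card_bool, Finset.prod_const, Finset.card_univ,
      Fintype.card_fin, Nat.cast_pow, Nat.cast_ofNat] at this
    simp only [le_div_iff₀ (show (0 : ℝ) < 2 ^ n by positivity)]
    convert this
  · simp only [Fintype.card_pi, Fintype.card_bool, Finset.prod_const, Finset.card_univ,
      Fintype.card_fin, Nat.cast_pow, Nat.cast_ofNat]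
    rw [lt_div_iff₀ (by positivity), two_mul, pow_add] at ha
    have hsum : ∀ x y : Fin n → Bool, ∑ i, (∑ j, A i j * signv (y j)) * signv (x i) =
        ∑ i, ∑ j, A i j * signv (x i) * signv (y j) := by
      intro x y
      refine Finset.sum_congr rfl fun i _ => ?_
      rw [Finset.sum_mul]
      exact Finset.sum_congr rfl fun j _ => by ring
    simp only [hsum]
    refine le_trans ?_ ha.le
    gcongr
    linarith

/-- The one-sided structure of a concentrated bilinear form: after subtracting suitable
combinations of boundedly many rows, almost all rows define concentrated linear forms. -/
lemma exists_concentrated_rows (ε C : ℝ) (hε0 : 0 < ε) (hε1 : ε < 1) (hC : 0 < C) :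
    ∃ (D : ℕ) (c B : ℝ), 0 < c ∧ 0 < B ∧ ∀ᶠ n : ℕ in Filter.atTop,
      ∀ A : Matrix (Fin n) (Fin n) ℝ, (n : ℝ) ^ (-C) ≤ rhoB n A →
      ∃ (W E : Finset (Fin n)) (s : ℕ), 0 < s ∧ (s : ℝ) ≤ (n : ℝ) ^ c ∧ W.card ≤ D ∧
        (E.card : ℝ) ≤ 2 * (c * (n : ℝ) ^ ε) ∧
        ∀ i, i ∉ E → ∃ k : Fin n → ℤ, (∀ w, |(k w : ℝ)| ≤ (n : ℝ) ^ c) ∧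
          (n : ℝ) ^ (-B) ≤ ((Finset.univ.filter fun y : Fin n → Bool =>
            ∑ j, (s * A i j - ∑ w ∈ W, (k w : ℝ) * A w j) * signv (y j) = 0).card : ℝ)
              / 2 ^ n := by
  obtain ⟨D, c, hc, hlin⟩ := exists_spanning_of_concentrated ε (C + 1) hε0 hε1 (by positivity)
  refine ⟨D, c, (C + 1) + (2 * D + c) + 1 + (2 + c) * D, hc, by positivity, ?_⟩
  filter_upwards [hlin, Filter.eventually_ge_atTop 4] with n hlin hn A hA
  have hn4 : (4 : ℝ) ≤ n := by exact_mod_cast hn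
  have hn1 : (1 : ℝ) ≤ n := by linarith
  have hn0 : (0 : ℝ) < n := by linarith
  have hnc1 : 1 ≤ (n : ℝ) ^ c := Real.one_le_rpow hn1 hc.le
  set M : ℕ := ⌊(n : ℝ) ^ c⌋₊ with hM
  have hMle : (M : ℝ) ≤ (n : ℝ) ^ c := Nat.floor_le (by positivity)
  have hM1 : 1 ≤ M := Nat.le_floor (by simpa using hnc1)
  obtain ⟨a, hY⟩ := exists_many_concentrated hn C A hA
  set b : (Fin n → Bool) → Fin n → ℝ := fun y i => ∑ j, A i j * signv (y j) with hb
  set Y := Finset.univ.filter fun y : Fin n → Bool => (n : ℝ) ^ (-(C + 1)) ≤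
        ((Finset.univ.filter fun x : Fin n → Bool =>
          ∑ i, (∑ j, A i j * signv (y j)) * signv (x i) = a).card : ℝ) / 2 ^ n with hYdef
  have hst := fun y (hy : y ∈ Y) => hlin (b y) a (Finset.mem_filter.1 hy).2
  choose! W E s hs0 hs hW hE hrel using hst
  choose! k hk hrel using hrel
  obtain ⟨⟨W₀, s₀⟩, hmem, hfib⟩ := Finset.exists_le_card_fiber_of_nsmul_le_card_of_maps_to
    (s := Y) (f := fun y => (W y, s y))
    (t := (Finset.univ.filter fun W : Finset (Fin n) => W.card ≤ D) ×ˢ Finset.Icc 1 M)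
    (b := (n : ℝ) ^ (-((C + 1) + (2 * D + c))) * 2 ^ n)
    (fun y hy => Finset.mem_product.2 ⟨Finset.mem_filter.2 ⟨Finset.mem_univ _, hW y hy⟩,
      Finset.mem_Icc.2 ⟨hs0 y hy, Nat.le_floor (hs y hy)⟩⟩)
    ⟨(∅, 1), by simp [hM1]⟩ (by
      refine le_trans ?_ hY
      rw [nsmul_eq_mul, Finset.card_product, Nat.card_Icc, Nat.add_sub_cancel, ← mul_assoc]
      refine mul_le_mul_of_nonneg_right ?_ (by positivity)
      have h1 : (((Finset.univ.filter fun W : Finset (Fin n) => W.card ≤ D).card : ℕ) : ℝ) ≤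
          (n : ℝ) ^ (2 * D : ℝ) := by
        calc _ ≤ ((n : ℝ) + 1) ^ D := by exact_mod_cast card_filter_card_le n D
          _ ≤ ((n : ℝ) ^ 2) ^ D := by gcongr; nlinarith
          _ = _ := by rw [← pow_mul, ← Real.rpow_natCast]; push_cast; rfl
      push_cast
      calc _ ≤ (n : ℝ) ^ (2 * D : ℝ) * (n : ℝ) ^ c * (n : ℝ) ^ (-((C + 1) + (2 * D + c))) := by
            gcongr
        _ = _ := by
            rw [← Real.rpow_add hn0, ← Real.rpow_add hn0]
            ring_nf)
  rw [Finset.mem_product, Finset.mem_filter, Finset.mem_Icc] at hmem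
  set Y₁ := Y.filter fun y => (W y, s y) = (W₀, s₀) with hY₁
  have hY₁Y : ∀ y ∈ Y₁, y ∈ Y ∧ W y = W₀ ∧ s y = s₀ := fun y hy => by
    simpa [hY₁] using hy
  have hY₁0 : Y₁.Nonempty := by
    rw [← Finset.card_pos]
    have : (0 : ℝ) < Y₁.card := lt_of_lt_of_le (by positivity) hfib
    exact_mod_cast this
  refine ⟨W₀, _, s₀, hmem.2.1, (Nat.cast_le.2 hmem.2.2).trans hMle, hmem.1.2,
    card_often_mem_le Y₁ hY₁0 E _ fun y hy => hE y (hY₁Y y hy).1, fun i hi => ?_⟩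
  rw [Finset.mem_filter, not_and, not_lt] at hi
  have hi := hi (Finset.mem_univ _)
  set Y₂ := Y₁.filter fun y => i ∉ E y with hY₂
  have hY₂c : (Y₁.card : ℝ) ≤ 2 * Y₂.card := by
    have h1 : (Y₁.filter fun y => i ∈ E y).card + Y₂.card = Y₁.card := by
      convert Finset.card_filter_add_card_filter_not (s := Y₁) fun y => i ∈ E y
    have h2 : 2 * (Y₁.filter fun y => i ∈ E y).card ≤ Y₁.card :=
      le_of_eq_of_le (by congr!) hi
    exact_mod_cast (by omega : Y₁.card ≤ 2 * Y₂.card)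
  obtain ⟨κ, hκ, hfib₂⟩ := Finset.exists_le_card_fiber_of_nsmul_le_card_of_maps_to
    (s := Y₂) (f := fun y w => if w ∈ W₀ then k y i w else 0)
    (t := Fintype.piFinset fun w => if w ∈ W₀ then Finset.Icc (-(M : ℤ)) M else {0})
    (b := (n : ℝ) ^ (-((C + 1) + (2 * D + c) + 1 + (2 + c) * D)) * 2 ^ n)
    (fun y hy => Fintype.mem_piFinset.2 fun w => by
      have hy' := Finset.mem_filter.1 hy
      split_ifs with hw
      · rw [Finset.mem_Icc, ← abs_le]
        have h1 := hk y (hY₁Y y hy'.1).1 i hy'.2 w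
        rw [← Int.cast_abs] at h1
        rw [hM, Int.natCast_floor_eq_floor (by positivity)]
        exact Int.le_floor.2 h1
      · simp)
    ⟨0, Fintype.mem_piFinset.2 fun w => by split_ifs <;> simp⟩ (by
      have h1 : (((Fintype.piFinset fun w => if w ∈ W₀ then Finset.Icc (-(M : ℤ)) M
          else {0}).card : ℕ) : ℝ) ≤ (n : ℝ) ^ ((2 + c) * D) := by
        have h2 : ∀ w, (if w ∈ W₀ then Finset.Icc (-(M : ℤ)) M else {0}).card =
            if w ∈ W₀ then 2 * M + 1 else 1 := by
          intro w
          split_ifs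
          · rw [Int.card_Icc]; omega
          · simp
        rw [Fintype.card_piFinset, Finset.prod_congr rfl fun w _ => h2 w, Finset.prod_ite_mem,
          Finset.univ_inter, Finset.prod_const]
        push_cast
        have hM1' : (1 : ℝ) ≤ M := by exact_mod_cast hM1
        calc (2 * (M : ℝ) + 1) ^ W₀.card ≤ (2 * (M : ℝ) + 1) ^ D :=
              pow_le_pow_right₀ (by linarith) hmem.1.2
          _ ≤ ((n : ℝ) ^ (2 + c)) ^ D := by
              gcongr
              rw [Real.rpow_add hn0, Real.rpow_two]
              have h3 : (3 : ℝ) ≤ n ^ 2 := by nlinarith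
              linarith [mul_le_mul h3 hMle (by positivity) (by positivity)]
          _ = _ := by rw [← Real.rpow_natCast, ← Real.rpow_mul hn0.le]
      rw [nsmul_eq_mul, ← mul_assoc]
      have h3 : (n : ℝ) ^ (-((C + 1) + (2 * D + c))) * 2 ^ n ≤ 2 * Y₂.card := hfib.trans hY₂c
      have h4 : (n : ℝ) ^ ((2 + c) * D) *
          (n : ℝ) ^ (-((C + 1) + (2 * D + c) + 1 + (2 + c) * D)) * n =
          (n : ℝ) ^ (-((C + 1) + (2 * D + c))) := by
        rw [← Real.rpow_add hn0, ← Real.rpow_add_one hn0.ne']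
        ring_nf
      have h5 : 2 * ((n : ℝ) ^ ((2 + c) * D) *
          (n : ℝ) ^ (-((C + 1) + (2 * D + c) + 1 + (2 + c) * D))) ≤
          (n : ℝ) ^ (-((C + 1) + (2 * D + c))) := by
        rw [← h4, mul_comm]
        gcongr
        linarith
      have h6 : 2 * ((n : ℝ) ^ ((2 + c) * D) *
          (n : ℝ) ^ (-((C + 1) + (2 * D + c) + 1 + (2 + c) * D)) * 2 ^ n) ≤ 2 * Y₂.card := by
        refine le_trans ?_ h3
        rw [← mul_assoc]
        gcongr
      refine le_trans ?_ (le_of_mul_le_mul_left h6 two_pos)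
      gcongr)
  refine ⟨κ, fun w => ?_, ?_⟩
  · have hw := Fintype.mem_piFinset.1 hκ w
    split_ifs at hw with hwW
    · rw [Finset.mem_Icc, ← abs_le] at hw
      refine le_trans ?_ hMle
      exact_mod_cast hw
    · rw [Finset.mem_singleton] at hw
      rw [hw]
      simpa using zero_le_one.trans hnc1
  · rw [le_div_iff₀ (by positivity)]
    refine hfib₂.trans ?_
    refine Nat.cast_le.2 (Finset.card_le_card fun y hy => ?_)
    obtain ⟨hy₂, hyκ⟩ := Finset.mem_filter.1 hy
    obtain ⟨hy₁, hiE⟩ := Finset.mem_filter.1 hy₂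
    obtain ⟨hyY, hyW, hys⟩ := hY₁Y y hy₁
    refine Finset.mem_filter.2 ⟨Finset.mem_univ _, ?_⟩
    have hr := hrel y hyY i hiE
    rw [hyW, hys] at hr
    have h1 : ∑ w ∈ W₀, (k y i w : ℝ) * b y w = ∑ w ∈ W₀, (κ w : ℝ) * b y w := by
      refine Finset.sum_congr rfl fun w hw => ?_
      have := congrFun hyκ w
      simp only [hw, if_true] at this
      rw [this]
    rw [h1] at hr
    have h2 : ∑ w ∈ W₀, (κ w : ℝ) * b y w =
        ∑ j, (∑ w ∈ W₀, (κ w : ℝ) * A w j) * signv (y j) := by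
      simp only [hb, Finset.mul_sum, Finset.sum_mul]
      rw [Finset.sum_comm]
      exact Finset.sum_congr rfl fun j _ => Finset.sum_congr rfl fun w _ => by ring
    have h3 : (s₀ : ℝ) * b y i = ∑ j, s₀ * A i j * signv (y j) := by
      simp only [hb, Finset.mul_sum]
      exact Finset.sum_congr rfl fun j _ => by ring
    simp only [sub_mul, Finset.sum_sub_distrib]
    rw [← h2, ← h3, hr, sub_self]

/-- Inverse Littlewood-Offord theorem for bilinear forms. -/
theorem inverse_LO_bilinear (ε C : ℝ) (hε0 : 0 < ε) (hε1 : ε < 1) (hC : 0 < C) :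
    ∃ r₀ : ℕ, ∃ c : ℝ, 0 < c ∧ ∃ n₀ : ℕ, ∀ n : ℕ, n₀ ≤ n →
      ∀ A : Matrix (Fin n) (Fin n) ℝ, (n : ℝ) ^ (-C) ≤ rhoB n A →
        ∃ (I₀ J₀ I J : Finset (Fin n)) (k l : ℤ) (kk ll : Fin n → Fin n → ℤ)
          (a' : Fin n → Fin n → ℝ),
          I₀.card ≤ r₀ ∧ J₀.card ≤ r₀ ∧
          (n : ℝ) - c * (n : ℝ) ^ ε ≤ (I.card : ℝ) ∧
          (n : ℝ) - c * (n : ℝ) ^ ε ≤ (J.card : ℝ) ∧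
          Disjoint I I₀ ∧ Disjoint J J₀ ∧
          k ≠ 0 ∧ l ≠ 0 ∧ |(k : ℝ)| ≤ (n : ℝ) ^ c ∧ |(l : ℝ)| ≤ (n : ℝ) ^ c ∧
          (∀ i ∈ I, ∀ i₀ ∈ I₀, |(kk i i₀ : ℝ)| ≤ (n : ℝ) ^ c) ∧
          (∀ j ∈ J, ∀ j₀ ∈ J₀, |(ll j₀ j : ℝ)| ≤ (n : ℝ) ^ c) ∧
          ∀ i ∈ I,
            (∀ j ∈ J, A i j = a' i j / ((k : ℝ) * (l : ℝ))
                - (∑ i₀ ∈ I₀, (kk i i₀ : ℝ) * A i₀ j) / (k : ℝ)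
                - (∑ j₀ ∈ J₀, (ll j₀ j : ℝ) * A i j₀) / (l : ℝ)) ∧
            (∃ Q : Set ℝ, IsProperSymGAPSet Q r₀ ((n : ℝ) ^ c) ∧
              ((J.filter fun j => a' i j ∉ Q).card : ℝ) ≤ c * (n : ℝ) ^ ε) := by
  obtain ⟨D₁, c₁, B, hc₁, hB, hrows⟩ := exists_concentrated_rows ε C hε0 hε1 hC
  obtain ⟨D₂, c₂, hc₂, hlin⟩ := exists_spanning_of_concentrated ε B hε0 hε1 hB
  have hD₁ : (0 : ℝ) ≤ D₁ := Nat.cast_nonneg _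
  set P : ℝ := (1 + c₂) * ((D₂ * 2 ^ D₂ : ℕ) : ℝ) with hP
  have hP0 : 0 ≤ P := by positivity
  refine ⟨D₁ + D₂, 2 * c₁ + D₁ + c₂ + P, by positivity, ?_⟩
  set c : ℝ := 2 * c₁ + D₁ + c₂ + P with hc
  rw [← Filter.eventually_atTop]
  filter_upwards [hrows, hlin, Filter.eventually_ge_atTop 4] with n hrows hlin hn A hA
  have hn4 : (4 : ℝ) ≤ n := by exact_mod_cast hn
  have hn1 : (1 : ℝ) ≤ n := by linarith
  have hn0 : (0 : ℝ) < n := by linarith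
  have hnε : 1 ≤ (n : ℝ) ^ ε := Real.one_le_rpow hn1 hε0.le
  have hmono : ∀ x, x ≤ c → (n : ℝ) ^ x ≤ (n : ℝ) ^ c := fun x hx =>
    Real.rpow_le_rpow_of_exponent_le hn1 hx
  obtain ⟨W, E, s, hs0, hs, hW, hE, hrel⟩ := hrows A hA
  choose! κ hκ hconc using hrel
  have hs0' : (s : ℝ) ≠ 0 := by exact_mod_cast hs0.ne'
  have hc1 : (n : ℝ) ^ c₁ ≤ (n : ℝ) ^ c := hmono _ (by linarith)
  refine ⟨W, ∅, (E ∪ W)ᶜ, Finset.univ, s, 1, fun i w => -κ i w, 0,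
    fun i j => s * A i j - ∑ w ∈ W, (κ i w : ℝ) * A w j, by omega, by simp, ?_, ?_, ?_, by simp,
    by exact_mod_cast hs0.ne', one_ne_zero, ?_, ?_, ?_, by simp, fun i hi => ⟨fun j _ => ?_, ?_⟩⟩
  · have h1 := Finset.card_add_card_compl (E ∪ W)
    rw [Fintype.card_fin] at h1
    have h2 : ((E ∪ W).card : ℝ) + ((E ∪ W)ᶜ.card : ℝ) = n := by exact_mod_cast h1
    have h3 : ((E ∪ W).card : ℝ) ≤ E.card + D₁ := by
      exact_mod_cast (Finset.card_union_le E W).trans (by omega)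
    have h4 : (2 * c₁ + D₁) * (n : ℝ) ^ ε ≤ c * (n : ℝ) ^ ε := by
      gcongr
      linarith
    nlinarith
  · rw [Finset.card_univ, Fintype.card_fin]
    have : 0 ≤ c * (n : ℝ) ^ ε := by positivity
    linarith
  · exact disjoint_compl_left.mono_right Finset.subset_union_right
  · simpa using hs.trans hc1
  · simpa using Real.one_le_rpow hn1 (show 0 ≤ c by positivity)
  · intro i hi w _
    have hiE : i ∉ E := fun h => Finset.mem_compl.1 hi (Finset.mem_union_left _ h)
    simpa using (hκ i hiE w).trans hc1
  · simp only [Int.cast_natCast, Int.cast_one, mul_one, Int.cast_neg, neg_mul,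
      Finset.sum_neg_distrib, Finset.sum_empty, zero_div, sub_zero]
    field_simp
    ring
  · have hiE : i ∉ E := fun h => Finset.mem_compl.1 hi (Finset.mem_union_left _ h)
    obtain ⟨V, F, q, hq0, -, hV, hF, hspan⟩ := hlin _ 0 (hconc i hiE)
    have hq0' : (q : ℝ) ≠ 0 := by exact_mod_cast hq0.ne'
    have hnc2 : 1 ≤ (n : ℝ) ^ c₂ := Real.one_le_rpow hn1 hc₂.le
    obtain ⟨Q, hQ, hmem⟩ := exists_proper_gap_of_finset V
      (fun w => (s * A i w - ∑ u ∈ W, (κ i u : ℝ) * A u w) / q) ⌊(n : ℝ) ^ c₂⌋₊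
      (Nat.le_floor (by simpa using hnc2))
    refine ⟨Q, hQ.mono (by omega) ?_, ?_⟩
    · have hfl : ((⌊(n : ℝ) ^ c₂⌋₊ : ℕ) : ℝ) ≤ (n : ℝ) ^ c₂ := Nat.floor_le (by positivity)
      calc (4 * (⌊(n : ℝ) ^ c₂⌋₊ : ℝ)) ^ (V.card * 2 ^ V.card)
          ≤ ((n : ℝ) ^ (1 + c₂)) ^ (V.card * 2 ^ V.card) := by
            gcongr
            rw [Real.rpow_add hn0, Real.rpow_one]
            gcongr
        _ ≤ ((n : ℝ) ^ (1 + c₂)) ^ (D₂ * 2 ^ D₂) :=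
            pow_le_pow_right₀ (Real.one_le_rpow hn1 (by linarith))
              (Nat.mul_le_mul hV (Nat.pow_le_pow_right two_pos hV))
        _ = (n : ℝ) ^ P := by rw [← Real.rpow_natCast, ← Real.rpow_mul hn0.le]
        _ ≤ _ := hmono _ (by linarith)
    · have hsub : (Finset.univ.filter fun j =>
          s * A i j - ∑ w ∈ W, (κ i w : ℝ) * A w j ∉ Q) ⊆ F := by
        intro j hj
        by_contra hjF
        refine (Finset.mem_filter.1 hj).2 ?_
        obtain ⟨m, hm, hrel⟩ := hspan j hjF
        have h1 := hmem m fun w => by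
          rw [Int.natCast_floor_eq_floor (by positivity)]
          refine Int.le_floor.2 ?_
          rw [Int.cast_abs]
          exact hm w
        convert h1 using 1
        refine mul_left_cancel₀ hq0' (hrel.trans ?_)
        rw [Finset.mul_sum]
        refine Finset.sum_congr rfl fun w _ => ?_
        rw [mul_left_comm, mul_div_cancel₀ _ hq0']
      calc _ ≤ (F.card : ℝ) := by exact_mod_cast Finset.card_le_card hsub
        _ ≤ c₂ * (n : ℝ) ^ ε := hF
        _ ≤ c * (n : ℝ) ^ ε := by
            gcongr
            linarith

end
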